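/- arXiv:2401.12605 — 7 statements merged into one kernel-verified Lean document; each statement's English description precedes it below -/
import Mathlib

section
/- For every integer m ≥ 2, every symmetric positive definite m×m real matrix A and every β ∈ ℝ, the strict inequality 2(1+β) ∫_{S^{m-1}} (⟨θ,A²θ⟩/⟨θ,Aθ⟩) μ_{A,β}(dθ) > tr(A) holds if and only if β > m/2 − 1. -/
open MeasureTheory Metric Filter
open scoped InnerProductSpace RealInnerProductSpace ENNReal NNReal

noncomputable section

/-- The uniform (normalized rotation-invariant) probability measure on the unit sphere
`S^{m-1}` of Euclidean `ℝ^m`, obtained by normalizing the canonical sphere measure induced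
by the Lebesgue (Haar) measure. -/
def sphereUniform (m : ℕ) : Measure (sphere (0 : EuclideanSpace ℝ (Fin m)) 1) :=
  (((volume : Measure (EuclideanSpace ℝ (Fin m))).toSphere) Set.univ)⁻¹ •
    ((volume : Measure (EuclideanSpace ℝ (Fin m))).toSphere)

/-- The quadratic form `θ ↦ ⟨θ, A θ⟩` associated to a matrix `A`. -/
def quadForm {m : ℕ} (A : Matrix (Fin m) (Fin m) ℝ) (θ : EuclideanSpace ℝ (Fin m)) : ℝ :=
  ⟪θ, Matrix.toEuclideanLin A θ⟫_ℝ

/-- `Z(A,s) := ∫_{S^{m-1}} ⟨θ,Aθ⟩^{-s} dσ(θ)`. -/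
def Zfun {m : ℕ} (A : Matrix (Fin m) (Fin m) ℝ) (s : ℝ) : ℝ :=
  ∫ θ : sphere (0 : EuclideanSpace ℝ (Fin m)) 1, quadForm A ↑θ ^ (-s) ∂(sphereUniform m)

/-- The `β`-average eigenvalue `Λ(A,β) := Z(A,β)/Z(A,1+β)`. -/
def lambdaAvg {m : ℕ} (A : Matrix (Fin m) (Fin m) ℝ) (β : ℝ) : ℝ :=
  Zfun A β / Zfun A (1 + β)

/-- The probability measure `μ_{A,β}` on `S^{m-1}` with density
`θ ↦ ⟨θ,Aθ⟩^{-1-β}/Z(A,1+β)` with respect to the uniform measure `σ`. -/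
def muAB {m : ℕ} (A : Matrix (Fin m) (Fin m) ℝ) (β : ℝ) :
    Measure (sphere (0 : EuclideanSpace ℝ (Fin m)) 1) :=
  (sphereUniform m).withDensity fun θ =>
    ENNReal.ofReal (quadForm A ↑θ ^ (-(1 + β)) / Zfun A (1 + β))

namespace S3

lemma sum_basis {m : ℕ} (y : EuclideanSpace ℝ (Fin m)) :
    y = ∑ i, y i • EuclideanSpace.single i (1 : ℝ) := by
  ext j
  simp [Finset.sum_apply, Pi.single_apply]

/-- integrated divergence of the vector field `c(x) A x` -/
lemma div_lemma {m : ℕ} (A : Matrix (Fin m) (Fin m) ℝ) (c : EuclideanSpace ℝ (Fin m) → ℝ)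
    (hc : ContDiff ℝ 1 c) (hs : HasCompactSupport c) :
    Integrable (fun x => fderiv ℝ c x (Matrix.toEuclideanLin A x) + c x * A.trace) ∧
    ∫ x, (fderiv ℝ c x (Matrix.toEuclideanLin A x) + c x * A.trace) = 0 := by
  have hcont : Continuous (fderiv ℝ c) := hc.continuous_fderiv (by norm_num)
  have hLc : Continuous (Matrix.toEuclideanLin A : EuclideanSpace ℝ (Fin m) → _) :=
    LinearMap.continuous_of_finiteDimensional _
  have key : ∀ i : Fin m,
      Integrable (fun x => (Matrix.toEuclideanLin A x) i * fderiv ℝ c x (EuclideanSpace.single i 1)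
        + c x * A i i) ∧
      ∫ x, ((Matrix.toEuclideanLin A x) i * fderiv ℝ c x (EuclideanSpace.single i 1)
        + c x * A i i) = 0 := by
    intro i
    let l : EuclideanSpace ℝ (Fin m) →L[ℝ] ℝ :=
      (EuclideanSpace.proj i).comp (LinearMap.toContinuousLinearMap (Matrix.toEuclideanLin A))
    have hl : ∀ x, l x = (Matrix.toEuclideanLin A x) i := fun x => rfl
    have hli : l (EuclideanSpace.single i 1) = A i i := by
      rw [hl]; simp [Matrix.toEuclideanLin_apply]
    have hfd : ∀ x, fderiv ℝ l x = l := fun x => l.fderiv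
    have i1 : Integrable (fun x => l x * fderiv ℝ c x (EuclideanSpace.single i 1)) := by
      apply Continuous.integrable_of_hasCompactSupport
      · fun_prop
      · apply HasCompactSupport.mul_left
        exact (hs.fderiv (𝕜 := ℝ)).comp_left (g := fun T => T (EuclideanSpace.single i 1)) rfl
    have i2 : Integrable (fun x => c x * A i i) :=
      (hc.continuous.mul continuous_const).integrable_of_hasCompactSupport hs.mul_right
    have i3 : Integrable (fun x => l x * c x) :=
      (l.continuous.mul hc.continuous).integrable_of_hasCompactSupport hs.mul_left
    refine ⟨i1.add i2, ?_⟩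
    have := integral_mul_fderiv_eq_neg_fderiv_mul_of_integrable (μ := volume)
      (f := l) (g := c) (v := EuclideanSpace.single i 1)
      (by simpa only [hfd, hli, mul_comm] using i2) i1 i3
      (fun x _ => l.differentiableAt) (fun x _ => hc.differentiable (by norm_num) x)
    have h2 := integral_add i1 i2
    refine h2.trans ?_
    rw [this]
    simp only [hfd, hli, mul_comm (A i i), neg_add_cancel]
  have e : (fun x => fderiv ℝ c x (Matrix.toEuclideanLin A x) + c x * A.trace) =
      fun x => ∑ i, ((Matrix.toEuclideanLin A x) i * fderiv ℝ c x (EuclideanSpace.single i 1)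
        + c x * A i i) := by
    ext x
    rw [Finset.sum_add_distrib, ← Finset.mul_sum]
    congr 1
    conv_lhs => rw [sum_basis (Matrix.toEuclideanLin A x)]
    rw [map_sum]
    simp
  rw [e]
  exact ⟨integrable_finsetSum _ fun i _ => (key i).1, by
    rw [integral_finsetSum _ fun i _ => (key i).1]; exact Finset.sum_eq_zero fun i _ => (key i).2⟩

/-- the radial cut-off -/
def bmp : ContDiffBump (2 : ℝ) := ⟨1/2, 1, by norm_num, by norm_num⟩

def chi (t : ℝ) : ℝ := bmp t

lemma chi_zero {t : ℝ} (h : t ≤ 1 ∨ 3 ≤ t) : chi t = 0 := by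
  apply bmp.zero_of_le_dist
  change 1 ≤ dist t 2
  rw [Real.dist_eq]
  rcases h with h | h
  · rw [abs_of_nonpos] <;> linarith
  · rw [abs_of_nonneg] <;> linarith

lemma chi_two : chi 2 = 1 := bmp.one_of_mem_closedBall (by simp [bmp])

lemma chi_nonneg (t : ℝ) : 0 ≤ chi t := bmp.nonneg

lemma chi_contDiff : ContDiff ℝ 1 chi := bmp.contDiff

variable {m : ℕ}

lemma cut_contDiff (f : EuclideanSpace ℝ (Fin m) → ℝ)
    (hf : ∀ x, x ≠ 0 → ContDiffAt ℝ 1 f x) :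
    ContDiff ℝ 1 (fun x => chi (‖x‖ ^ 2) * f x) := by
  rw [contDiff_iff_contDiffAt]
  intro x
  by_cases hx : x = 0
  · subst hx
    have : (fun x : EuclideanSpace ℝ (Fin m) => chi (‖x‖ ^ 2) * f x) =ᶠ[nhds 0] fun _ => 0 := by
      filter_upwards [ball_mem_nhds (0 : EuclideanSpace ℝ (Fin m)) one_pos] with y hy
      rw [chi_zero, zero_mul]
      left
      have : ‖y‖ < 1 := by simpa using hy
      nlinarith [norm_nonneg y]
    exact contDiffAt_const.congr_of_eventuallyEq this
  · have h1 : ContDiff ℝ 1 (fun x : EuclideanSpace ℝ (Fin m) => chi (‖x‖ ^ 2)) :=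
      chi_contDiff.comp (contDiff_norm_sq ℝ)
    exact h1.contDiffAt.mul (hf x hx)

lemma cut_compact (f : EuclideanSpace ℝ (Fin m) → ℝ) :
    HasCompactSupport (fun x => chi (‖x‖ ^ 2) * f x) := by
  apply HasCompactSupport.intro (isCompact_closedBall (0 : EuclideanSpace ℝ (Fin m)) 3)
  intro x hx
  rw [chi_zero, zero_mul]
  right
  have : 3 < ‖x‖ := by simpa using hx
  nlinarith

/-- polar coordinates for a radial cut-off times a homogeneous function -/
lemma polar (hm : 2 ≤ m) (s : ℝ) : ∃ R : ℝ, ∀ H : EuclideanSpace ℝ (Fin m) → ℝ,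
    (∀ r : ℝ, 0 < r → ∀ x, H (r • x) = (r ^ 2) ^ (-s) * H x) →
    ∫ x, chi (‖x‖ ^ 2) * H x =
      (∫ θ : sphere (0 : EuclideanSpace ℝ (Fin m)) 1, H θ
        ∂(volume : Measure (EuclideanSpace ℝ (Fin m))).toSphere) * R := by
  haveI : Nontrivial (EuclideanSpace ℝ (Fin m)) := by
    haveI : Nonempty (Fin m) := ⟨⟨0, by omega⟩⟩
    infer_instance
  set E := EuclideanSpace ℝ (Fin m)
  refine ⟨∫ r : Set.Ioi (0 : ℝ), chi (r.1 ^ 2) * (r.1 ^ 2) ^ (-s)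
    ∂(Measure.volumeIoiPow (Module.finrank ℝ E - 1)), fun H hH => ?_⟩
  rw [← integral_prod_mul (μ := (volume : Measure E).toSphere) (fun θ : sphere (0 : E) 1 => H θ)
    (fun r : Set.Ioi (0 : ℝ) => chi (r.1 ^ 2) * (r.1 ^ 2) ^ (-s))]
  rw [← (volume : Measure E).measurePreserving_homeomorphUnitSphereProd.integral_comp
    (Homeomorph.measurableEmbedding _)]
  have := integral_subtype_comap (μ := (volume : Measure E)) (measurableSet_singleton (0 : E)).compl
    fun x ↦ chi (‖x‖ ^ 2) * H x
  rw [restrict_compl_singleton] at this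
  rw [← this]
  congr 1
  ext x
  have hx : (x : E) ≠ 0 := x.2
  have hp : 0 < ‖(x : E)‖ := norm_pos_iff.2 hx
  simp only [homeomorphUnitSphereProd_apply_snd_coe, homeomorphUnitSphereProd_apply_fst_coe]
  have h := hH ‖(x : E)‖ hp (‖(x : E)‖⁻¹ • (x : E))
  rw [smul_inv_smul₀ hp.ne'] at h
  rw [h]
  ring

section quad
variable (A : Matrix (Fin m) (Fin m) ℝ)

lemma quad_pos (hA : A.PosDef) (x : EuclideanSpace ℝ (Fin m)) (hx : x ≠ 0) : 0 < quadForm A x := by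
  have := hA.dotProduct_mulVec_pos (x := x.ofLp) (by simpa using hx)
  simpa [quadForm, Matrix.toEuclideanLin_apply, EuclideanSpace.inner_eq_star_dotProduct,
    dotProduct_comm] using this

lemma quad_smul (r : ℝ) (x : EuclideanSpace ℝ (Fin m)) :
    quadForm A (r • x) = r ^ 2 * quadForm A x := by
  simp [quadForm, inner_smul_left, inner_smul_right]; ring

lemma quad_one (x : EuclideanSpace ℝ (Fin m)) : quadForm 1 x = ‖x‖ ^ 2 := by
  simp [quadForm, Matrix.toEuclideanLin_apply]

lemma symm (hA : A.PosDef) (x y : EuclideanSpace ℝ (Fin m)) :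
    ⟪Matrix.toEuclideanLin A x, y⟫_ℝ = ⟪x, Matrix.toEuclideanLin A y⟫_ℝ :=
  Matrix.isSymmetric_toEuclideanLin_iff.2 hA.1 x y

lemma quad_sq (hA : A.PosDef) (x : EuclideanSpace ℝ (Fin m)) :
    ⟪Matrix.toEuclideanLin A x, Matrix.toEuclideanLin A x⟫_ℝ = quadForm (A * A) x := by
  rw [symm A hA]
  simp [quadForm, Matrix.toEuclideanLin_apply, Matrix.mulVec_mulVec]

lemma quad_contDiff : ContDiff ℝ 1 (quadForm A) := by
  have : ContDiff ℝ 1 (fun x : EuclideanSpace ℝ (Fin m) => Matrix.toEuclideanLin A x) :=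
    (LinearMap.toContinuousLinearMap (Matrix.toEuclideanLin A)).contDiff
  exact contDiff_id.inner ℝ this

lemma quad_line (hA : A.PosDef) (x v : EuclideanSpace ℝ (Fin m)) :
    HasDerivAt (fun t : ℝ => quadForm A (x + t • v)) (2 * ⟪Matrix.toEuclideanLin A x, v⟫_ℝ) 0 := by
  have e : (fun t : ℝ => quadForm A (x + t • v)) = fun t : ℝ =>
      quadForm A x + t * (2 * ⟪Matrix.toEuclideanLin A x, v⟫_ℝ) + t ^ 2 * quadForm A v := by
    ext t
    simp only [quadForm, map_add, map_smul, inner_add_left, inner_add_right, inner_smul_left,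
      inner_smul_right]
    rw [← symm A hA x v, real_inner_comm (Matrix.toEuclideanLin A x) v]
    simp; ring
  rw [e]
  have h := (((hasDerivAt_id (0:ℝ)).mul_const (2 * ⟪Matrix.toEuclideanLin A x, v⟫_ℝ)).const_add
    (quadForm A x)).add (((hasDerivAt_id (0:ℝ)).pow 2).mul_const (quadForm A v))
  refine h.congr_deriv ?_
  simp

lemma norm_line (x v : EuclideanSpace ℝ (Fin m)) :
    HasDerivAt (fun t : ℝ => ‖x + t • v‖ ^ 2) (2 * ⟪x, v⟫_ℝ) 0 := by
  have := quad_line (1 : Matrix (Fin m) (Fin m) ℝ) Matrix.PosDef.one x v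
  simpa [quad_one, Matrix.toEuclideanLin_apply] using this

lemma fderiv_line {f : EuclideanSpace ℝ (Fin m) → ℝ} (hf : ContDiff ℝ 1 f)
    {x v : EuclideanSpace ℝ (Fin m)} {d : ℝ}
    (h : HasDerivAt (fun t : ℝ => f (x + t • v)) d 0) : fderiv ℝ f x v = d :=
  ((hf.differentiable (by norm_num) x).hasFDerivAt.hasLineDerivAt v).unique h

lemma rpow_contDiffAt (hA : A.PosDef) (s : ℝ) (x : EuclideanSpace ℝ (Fin m)) (hx : x ≠ 0) :
    ContDiffAt ℝ 1 (fun x => quadForm A x ^ s) x :=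
  (quad_contDiff A).contDiffAt.rpow_const_of_ne (quad_pos A hA x hx).ne'

/-- The homogeneous function whose spherical integral vanishes. -/
def HH (s : ℝ) (x : EuclideanSpace ℝ (Fin m)) : ℝ :=
  A.trace * quadForm A x ^ (-s) - 2 * s * (quadForm (A * A) x * quadForm A x ^ (-s - 1))
    + (2 * s - m) * ((‖x‖ ^ 2)⁻¹ * quadForm A x ^ (1 - s))

lemma int_zero (hA : A.PosDef) (s : ℝ) : ∫ x, chi (‖x‖ ^ 2) * HH A s x = 0 := by
  have c1 := cut_contDiff (fun x => quadForm A x ^ (-s)) (rpow_contDiffAt A hA (-s))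
  have s1 := cut_compact (fun x => quadForm A x ^ (-s))
  have c2 := cut_contDiff (fun x => (‖x‖ ^ 2)⁻¹ * quadForm A x ^ (1 - s)) (fun x hx =>
    (((contDiff_norm_sq ℝ).contDiffAt).inv (by simpa using hx)).mul (rpow_contDiffAt A hA (1-s) x hx))
  have s2 := cut_compact (fun x => (‖x‖ ^ 2)⁻¹ * quadForm A x ^ (1 - s))
  obtain ⟨i1, z1⟩ := div_lemma A _ c1 s1
  obtain ⟨i2, z2⟩ := div_lemma 1 _ c2 s2
  have := integral_sub i1 i2
  rw [z1, z2, sub_zero] at this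
  rw [← this]
  congr 1
  ext x
  by_cases hx : x = 0
  · subst hx
    simp [chi_zero]
  have hq := quad_pos A hA x hx
  have hn : 0 < ‖x‖ ^ 2 := by have := norm_pos_iff.2 hx; positivity
  have hchi : HasDerivAt chi (deriv chi (‖x‖ ^ 2)) (‖x‖ ^ 2) :=
    (chi_contDiff.differentiable (by norm_num) _).hasDerivAt
  have dchi : ∀ v, HasDerivAt (fun t : ℝ => chi (‖x + t • v‖ ^ 2))
      (deriv chi (‖x‖ ^ 2) * (2 * ⟪x, v⟫_ℝ)) 0 := fun v =>
    HasDerivAt.comp (h₂ := chi) (h := fun t : ℝ => ‖x + t • v‖ ^ 2) 0 (by simpa using hchi)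
      (norm_line x v)
  have dq : ∀ v (a : ℝ), HasDerivAt (fun t : ℝ => quadForm A (x + t • v) ^ a)
      (2 * ⟪Matrix.toEuclideanLin A x, v⟫_ℝ * a * quadForm A x ^ (a - 1)) 0 := fun v a => by
    simpa using (quad_line A hA x v).rpow_const (p := a) (Or.inl (by simpa using hq.ne'))
  have dn : HasDerivAt (fun t : ℝ => (‖x + t • x‖ ^ 2)⁻¹)
      (-(2 * ⟪x, x⟫_ℝ) / (‖x‖ ^ 2) ^ 2) 0 := by
    have := (norm_line x x).inv (by simpa using hx)
    simp only [zero_smul, add_zero] at this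
    exact this
  have f1 := fderiv_line c1 ((dchi (Matrix.toEuclideanLin A x)).mul (dq _ (-s)))
  have f2 := fderiv_line c2 ((dchi x).mul (dn.mul (dq x (1-s))))
  have e1 : Matrix.toEuclideanLin (1 : Matrix (Fin m) (Fin m) ℝ) x = x := by
    simp [Matrix.toEuclideanLin_apply]
  rw [e1, f1, f2, quad_sq A hA, symm A hA, real_inner_self_eq_norm_sq]
  have hQ : ⟪x, Matrix.toEuclideanLin A x⟫_ℝ = quadForm A x := rfl
  have p1 : quadForm A x ^ (1 - s) = quadForm A x * quadForm A x ^ (-s) := by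
    rw [sub_eq_add_neg, Real.rpow_add hq, Real.rpow_one]
  have p2 : (1 - s - 1) = -s := by ring
  simp only [zero_smul, add_zero, HH, Matrix.trace_one, Fintype.card_fin, hQ, p1, p2]
  field_simp
  ring

lemma HH_hom (hA : A.PosDef) (s r : ℝ) (hr : 0 < r) (x : EuclideanSpace ℝ (Fin m)) :
    HH A s (r • x) = (r ^ 2) ^ (-s) * HH A s x := by
  by_cases hx : x = 0
  · subst hx
    by_cases h : s = 0
    · subst h; simp [HH]
    · have : quadForm A (0 : EuclideanSpace ℝ (Fin m)) = 0 := by simp [quadForm]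
      have h2 : quadForm (A * A) (0 : EuclideanSpace ℝ (Fin m)) = 0 := by simp [quadForm]
      simp [HH, this, h2, Real.zero_rpow, h]
  have hq := (quad_pos A hA x hx).le
  have hr2 : 0 < r ^ 2 := by positivity
  have hn : 0 < ‖x‖ := norm_pos_iff.2 hx
  simp only [HH, quad_smul, norm_smul, Real.norm_eq_abs, abs_of_pos hr, mul_pow]
  rw [Real.mul_rpow hr2.le hq, Real.mul_rpow hr2.le hq, Real.mul_rpow hr2.le hq,
    sub_eq_add_neg 1 s, Real.rpow_add hr2 1 (-s), Real.rpow_sub hr2 (-s) 1, Real.rpow_one]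
  field_simp

lemma sphere_zero (hm : 2 ≤ m) (hA : A.PosDef) (s : ℝ) :
    ∫ θ : sphere (0 : EuclideanSpace ℝ (Fin m)) 1, HH A s θ
      ∂(volume : Measure (EuclideanSpace ℝ (Fin m))).toSphere = 0 := by
  obtain ⟨R, hR⟩ := polar hm s
  have h1 := hR _ (HH_hom A hA s)
  rw [int_zero A hA] at h1
  rcases mul_eq_zero.1 h1.symm with h | h
  · exact h
  exfalso
  have h2 := hR (fun x => (‖x‖ ^ 2) ^ (-s)) (fun r hr x => by
    rw [norm_smul, Real.norm_eq_abs, abs_of_pos hr, mul_pow, Real.mul_rpow] <;> positivity)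
  rw [h, mul_zero] at h2
  have c := cut_contDiff (fun x : EuclideanSpace ℝ (Fin m) => quadForm 1 x ^ (-s))
    (rpow_contDiffAt 1 Matrix.PosDef.one (-s))
  have cs := cut_compact (fun x : EuclideanSpace ℝ (Fin m) => quadForm 1 x ^ (-s))
  simp only [quad_one] at c cs
  have hpos := c.continuous.integral_pos_of_hasCompactSupport_nonneg_nonzero (μ := volume) cs
    (x := EuclideanSpace.single ⟨0, by omega⟩ (Real.sqrt 2))
    (fun x => mul_nonneg (chi_nonneg _) (by positivity))
    (by simp [chi_two]; positivity)
  exact hpos.ne' h2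

end quad
end S3

/-- for every `m ≥ 2`, every symmetric positive definite `m×m` real matrix `A`
and every `β ∈ ℝ`, `2(1+β) ∫_{S^{m-1}} ⟨θ,A²θ⟩/⟨θ,Aθ⟩ μ_{A,β}(dθ) > tr(A) ↔ β > m/2 - 1`. -/
theorem statement3 {m : ℕ} (hm : 2 ≤ m) (A : Matrix (Fin m) (Fin m) ℝ)
    (hA : A.PosDef) (β : ℝ) :
    2 * (1 + β) *
        (∫ θ : sphere (0 : EuclideanSpace ℝ (Fin m)) 1,
          quadForm (A * A) ↑θ / quadForm A ↑θ ∂(muAB A β)) > A.trace ↔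
      β > (m : ℝ) / 2 - 1 := by
  have hnt : Nontrivial (EuclideanSpace ℝ (Fin m)) := by
    have : Nonempty (Fin m) := ⟨⟨0, by omega⟩⟩
    infer_instance
  set S := sphere (0 : EuclideanSpace ℝ (Fin m)) 1 with hS
  have hν0 : (volume : Measure (EuclideanSpace ℝ (Fin m))).toSphere ≠ 0 :=
    Measure.toSphere_ne_zero _
  have hprob : IsProbabilityMeasure (sphereUniform m) := by
    constructor
    simp only [sphereUniform, Measure.smul_apply, smul_eq_mul]
    exact ENNReal.inv_mul_cancel (Measure.measure_univ_ne_zero.2 hν0) (measure_ne_top _ _)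
  have hpos : ∀ θ : S, 0 < quadForm A (θ : EuclideanSpace ℝ (Fin m)) := fun θ =>
    S3.quad_pos A hA _ (ne_of_mem_sphere θ.2 one_ne_zero)
  have hqc : Continuous (fun θ : S => quadForm A (θ : EuclideanSpace ℝ (Fin m))) :=
    (S3.quad_contDiff A).continuous.comp continuous_subtype_val
  have hpc : Continuous (fun θ : S => quadForm (A * A) (θ : EuclideanSpace ℝ (Fin m))) :=
    (S3.quad_contDiff (A * A)).continuous.comp continuous_subtype_val
  have hrc : ∀ a : ℝ, Continuous (fun θ : S => quadForm A (θ : EuclideanSpace ℝ (Fin m)) ^ a) :=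
    fun a => hqc.rpow_const fun θ => Or.inl (hpos θ).ne'
  have hint : ∀ f : S → ℝ, Continuous f → Integrable f (sphereUniform m) := fun f hf =>
    hf.integrable_of_hasCompactSupport (HasCompactSupport.of_compactSpace f)
  have hposI : ∀ a : ℝ, 0 < ∫ θ : S, quadForm A (θ : EuclideanSpace ℝ (Fin m)) ^ a
      ∂(sphereUniform m) := fun a => by
    rw [integral_pos_iff_support_of_nonneg (fun θ => (Real.rpow_pos_of_pos (hpos θ) a).le)
      (hint _ (hrc a))]
    have : Function.support (fun θ : S => quadForm A (θ : EuclideanSpace ℝ (Fin m)) ^ a)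
        = Set.univ := by
      ext θ; simpa using (Real.rpow_pos_of_pos (hpos θ) a).ne'
    rw [this]; simp
  set s := 1 + β with hs
  have hZ : 0 < Zfun A s := hposI (-s)
  have h0 : ∫ θ : S, S3.HH A s θ ∂(sphereUniform m) = 0 := by
    rw [sphereUniform, integral_smul_measure, S3.sphere_zero A hm hA s, smul_zero]
  have hHH : ∀ θ : S, S3.HH A s θ = A.trace * quadForm A (θ : EuclideanSpace ℝ (Fin m)) ^ (-s)
      - 2 * s * (quadForm (A * A) (θ : EuclideanSpace ℝ (Fin m))
        * quadForm A (θ : EuclideanSpace ℝ (Fin m)) ^ (-s - 1))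
      + (2 * s - m) * quadForm A (θ : EuclideanSpace ℝ (Fin m)) ^ (1 - s) := fun θ => by
    have : ‖(θ : EuclideanSpace ℝ (Fin m))‖ = 1 := by simpa using θ.2
    simp [S3.HH, this]
  have iP : Integrable (fun θ : S => quadForm (A * A) (θ : EuclideanSpace ℝ (Fin m))
      * quadForm A (θ : EuclideanSpace ℝ (Fin m)) ^ (-s - 1)) (sphereUniform m) :=
    hint _ (hpc.mul (hrc (-s - 1)))
  have iD : Integrable (fun θ : S => A.trace * quadForm A (θ : EuclideanSpace ℝ (Fin m)) ^ (-s)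
      - 2 * s * (quadForm (A * A) (θ : EuclideanSpace ℝ (Fin m))
        * quadForm A (θ : EuclideanSpace ℝ (Fin m)) ^ (-s - 1))) (sphereUniform m) :=
    ((hint _ (hrc (-s))).const_mul _).sub (iP.const_mul _)
  simp only [hHH] at h0
  rw [integral_add iD
    ((hint _ (hrc (1 - s))).const_mul _), integral_sub ((hint _ (hrc (-s))).const_mul _)
    (iP.const_mul _), integral_const_mul, integral_const_mul, integral_const_mul] at h0
  have hmu : ∫ θ : S, quadForm (A * A) (θ : EuclideanSpace ℝ (Fin m)) /
        quadForm A (θ : EuclideanSpace ℝ (Fin m)) ∂(muAB A β) =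
      (∫ θ : S, quadForm (A * A) (θ : EuclideanSpace ℝ (Fin m))
        * quadForm A (θ : EuclideanSpace ℝ (Fin m)) ^ (-s - 1) ∂(sphereUniform m)) / Zfun A s := by
    rw [muAB, integral_withDensity_eq_integral_toReal_smul
      (((hrc (-s)).div_const _).measurable.ennreal_ofReal) (by simp), ← integral_div]
    congr 1
    ext θ
    have hq := hpos θ
    rw [ENNReal.toReal_ofReal (div_nonneg (Real.rpow_nonneg hq.le _) hZ.le),
      Real.rpow_sub hq, Real.rpow_one, smul_eq_mul]
    field_simp
  rw [hmu]
  change A.trace * Zfun A s - _ + _ = 0 at h0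
  have hJ := hposI (1 - s)
  set P := ∫ θ : S, quadForm (A * A) (θ : EuclideanSpace ℝ (Fin m))
        * quadForm A (θ : EuclideanSpace ℝ (Fin m)) ^ (-s - 1) ∂(sphereUniform m)
  set J := ∫ θ : S, quadForm A (θ : EuclideanSpace ℝ (Fin m)) ^ (1 - s) ∂(sphereUniform m)
  have e : 2 * s * (P / Zfun A s) = A.trace + (2 * s - m) * (J / Zfun A s) := by
    field_simp
    linarith
  have hJZ : 0 < J / Zfun A s := div_pos hJ hZ
  rw [e, gt_iff_lt, lt_add_iff_pos_right, mul_pos_iff_of_pos_right hJZ]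
  constructor <;> intro h <;> linarith
end
end

section
/- For every integer m ≥ 2, every symmetric positive definite m×m real matrix A and every β ∈ ℝ, the strict inequality 2(1+β) ∫_{S^{m-1}} (⟨θ,A²θ⟩/⟨θ,Aθ⟩) μ_{A,β}(dθ) < tr(A) holds if and only if β < m/2 − 1. -/
open MeasureTheory Metric Filter
open scoped InnerProductSpace RealInnerProductSpace ENNReal NNReal

noncomputable section

namespace SphereAux

abbrev EE (m : ℕ) := EuclideanSpace ℝ (Fin m)

/-- the linear map of the matrix, as a continuous linear map -/
def TT {m : ℕ} (A : Matrix (Fin m) (Fin m) ℝ) : EE m →L[ℝ] EE m :=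
  LinearMap.toContinuousLinearMap (Matrix.toEuclideanLin A)

lemma quadForm_eq {m : ℕ} (A : Matrix (Fin m) (Fin m) ℝ) (x : EE m) :
    quadForm A x = ⟪x, TT A x⟫_ℝ := rfl

lemma TT_apply {m : ℕ} (A : Matrix (Fin m) (Fin m) ℝ) (x : EE m) (i : Fin m) :
    TT A x i = ∑ j, A i j * x j := by
  simp [TT, Matrix.toLpLin_apply, Matrix.mulVec, dotProduct]

lemma TT_symm {m : ℕ} {A : Matrix (Fin m) (Fin m) ℝ} (hA : A.PosDef) (x y : EE m) :
    ⟪x, TT A y⟫_ℝ = ⟪TT A x, y⟫_ℝ := by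
  have h := (Matrix.isSymmetric_toEuclideanLin_iff.2 hA.1) x y
  exact h.symm

lemma quadForm_sq {m : ℕ} {A : Matrix (Fin m) (Fin m) ℝ} (hA : A.PosDef) (x : EE m) :
    quadForm (A * A) x = ⟪TT A x, TT A x⟫_ℝ := by
  have : TT (A * A) x = TT A (TT A x) := by
    ext i
    simp [TT, Matrix.toLpLin_apply]
  rw [quadForm_eq, this, TT_symm hA]

lemma quadForm_pos {m : ℕ} {A : Matrix (Fin m) (Fin m) ℝ} (hA : A.PosDef) {x : EE m}
    (hx : x ≠ 0) : 0 < quadForm A x := by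
  have h := (Matrix.posDef_iff_dotProduct_mulVec.1 hA).2 (x := x.ofLp) (by simpa using hx)
  have e : quadForm A x = star x.ofLp ⬝ᵥ A.mulVec x.ofLp := by
    rw [quadForm_eq]
    simp [TT, Matrix.toLpLin_apply, EuclideanSpace.inner_eq_star_dotProduct, dotProduct_comm]
  rw [e]; exact h

lemma quadForm_smul {m : ℕ} (A : Matrix (Fin m) (Fin m) ℝ) (r : ℝ) (x : EE m) :
    quadForm A (r • x) = r ^ 2 * quadForm A x := by
  simp only [quadForm_eq, map_smul, inner_smul_left, inner_smul_right]
  simp; ring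

lemma quadForm_contDiff {m : ℕ} (A : Matrix (Fin m) (Fin m) ℝ) :
    ContDiff ℝ 1 (quadForm A) := by
  have : quadForm A = fun x : EE m => ⟪x, TT A x⟫_ℝ := rfl
  rw [this]; exact contDiff_id.inner ℝ (TT A).contDiff

lemma quadForm_hasFDerivAt {m : ℕ} {A : Matrix (Fin m) (Fin m) ℝ} (hA : A.PosDef) (x : EE m) :
    HasFDerivAt (quadForm A) ((2 : ℝ) • innerSL ℝ (TT A x)) x := by
  have h := (hasFDerivAt_id x).inner ℝ ((TT A).hasFDerivAt (x := x))
  refine h.congr_fderiv ?_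
  ext v
  have h1 : ⟪v, TT A x⟫_ℝ = ⟪TT A x, v⟫_ℝ := real_inner_comm _ _
  simp [TT_symm hA x v, h1]
  ring

/-- the divergence identity -/
lemma div_identity {m : ℕ} (A : Matrix (Fin m) (Fin m) ℝ) {f : EE m → ℝ}
    (hf : ContDiff ℝ 1 f) (hc : HasCompactSupport f) :
    ∫ x, (A.trace * f x + fderiv ℝ f x (TT A x)) = 0 := by
  have hf' : Continuous (fderiv ℝ f) := hf.continuous_fderiv (by norm_num)
  have hc' : HasCompactSupport (fderiv ℝ f) := hc.fderiv ℝ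
  let e : Fin m → EE m := fun i => EuclideanSpace.single i 1
  let c : Fin m → (EE m →L[ℝ] ℝ) := fun i => (EuclideanSpace.proj i).comp (TT A)
  have hIntg : ∀ i, Integrable (fun x => c i x * fderiv ℝ f x (e i)) := by
    intro i
    apply Continuous.integrable_of_hasCompactSupport
    · fun_prop
    · apply HasCompactSupport.mul_left
      exact hc'.comp_left (g := fun L : EE m →L[ℝ] ℝ => L (e i)) (by simp)
  have hfi : Integrable f := hf.continuous.integrable_of_hasCompactSupport hc
  have hce : ∀ i, c i (e i) = A i i := by
    intro i
    simp [c, e, TT_apply]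
  have key : ∀ i, ∫ x, c i x * fderiv ℝ f x (e i) = - (A i i * ∫ x, f x) := by
    intro i
    have := integral_mul_fderiv_eq_neg_fderiv_mul_of_integrable (μ := (volume : Measure (EE m)))
      (f := c i) (g := f) (v := e i) ?_ (hIntg i) ?_ ?_ ?_
    · rw [this]
      simp only [ContinuousLinearMap.fderiv, hce, integral_const_mul]
    · simp only [ContinuousLinearMap.fderiv]
      exact hfi.const_mul _
    · apply Continuous.integrable_of_hasCompactSupport
      · have := hf.continuous
        fun_prop
      · exact hc.mul_left
    · intro x _; exact (c i).differentiableAt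
    · intro x _; exact (hf.differentiable (by norm_num)).differentiableAt
  have hexp : ∀ x, fderiv ℝ f x (TT A x) = ∑ i, c i x * fderiv ℝ f x (e i) := by
    intro x
    have h1 : TT A x = ∑ i, (c i x) • e i := by
      ext j
      simp [c, e, Finset.sum_apply, Pi.single_apply]
    conv_lhs => rw [h1]
    simp
  simp only [hexp]
  rw [integral_add (hfi.const_mul _) (integrable_finsetSum _ fun i _ => hIntg i),
    integral_finsetSum _ fun i _ => hIntg i, integral_const_mul]
  simp only [key, Matrix.trace, Matrix.diag]
  rw [Finset.sum_neg_distrib, ← Finset.sum_mul]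
  ring

/-- radial cutoff -/
def HH : ContDiffBump (2 : ℝ) := ⟨1 / 2, 1, by norm_num, by norm_num⟩

def ff {m : ℕ} (A : Matrix (Fin m) (Fin m) ℝ) (s p : ℝ) (x : EE m) : ℝ :=
  quadForm A x ^ (-s) * (‖x‖ ^ 2) ^ (-p) * HH (‖x‖ ^ 2)

lemma HH_zero {t : ℝ} (ht : t ≤ 1 ∨ 3 ≤ t) : HH t = 0 := by
  apply HH.zero_of_le_dist
  show (1 : ℝ) ≤ _
  rw [Real.dist_eq]
  rcases ht with h | h
  · rw [abs_of_nonpos (by linarith)]; linarith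
  · rw [abs_of_nonneg (by linarith)]; linarith

lemma ff_support {m : ℕ} (A : Matrix (Fin m) (Fin m) ℝ) (s p : ℝ) :
    HasCompactSupport (ff A s p) := by
  apply HasCompactSupport.of_support_subset_isCompact (isCompact_closedBall (0 : EE m) 3)
  intro x hx
  by_contra h
  simp only [mem_closedBall, dist_zero_right, not_le] at h
  apply hx
  have : HH (‖x‖ ^ 2) = 0 := HH_zero (Or.inr (by nlinarith))
  simp [ff, this]

lemma ff_contDiff {m : ℕ} {A : Matrix (Fin m) (Fin m) ℝ} (hA : A.PosDef) (s p : ℝ) :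
    ContDiff ℝ 1 (ff A s p) := by
  rw [contDiff_iff_contDiffAt]
  intro x
  by_cases hx : x = 0
  · subst hx
    have : ff A s p =ᶠ[nhds 0] fun _ => 0 := by
      filter_upwards [ball_mem_nhds (0 : EE m) one_pos] with y hy
      simp only [mem_ball, dist_zero_right] at hy
      have : HH (‖y‖ ^ 2) = 0 := HH_zero (Or.inl (by nlinarith [norm_nonneg y]))
      simp [ff, this]
    exact contDiffAt_const.congr_of_eventuallyEq this
  · have hn : ContDiff ℝ 1 (fun y : EE m => ‖y‖ ^ 2) := contDiff_norm_sq ℝ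
    refine ContDiffAt.mul (ContDiffAt.mul ?_ ?_) ?_
    · exact (quadForm_contDiff A).contDiffAt.rpow_const_of_ne (quadForm_pos hA hx).ne'
    · exact hn.contDiffAt.rpow_const_of_ne (by simpa using hx)
    · exact (HH.contDiff.comp hn).contDiffAt

lemma ff_fderiv {m : ℕ} {A : Matrix (Fin m) (Fin m) ℝ} (hA : A.PosDef) (s p : ℝ)
    {x : EE m} (hx : x ≠ 0) (v : EE m) :
    fderiv ℝ (ff A s p) x v =
      -s * quadForm A x ^ (-s - 1) * (2 * ⟪TT A x, v⟫_ℝ) * (‖x‖ ^ 2) ^ (-p) * HH (‖x‖ ^ 2)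
      + quadForm A x ^ (-s) * (-p * (‖x‖ ^ 2) ^ (-p - 1) * (2 * ⟪x, v⟫_ℝ)) * HH (‖x‖ ^ 2)
      + quadForm A x ^ (-s) * (‖x‖ ^ 2) ^ (-p) * (deriv HH (‖x‖ ^ 2) * (2 * ⟪x, v⟫_ℝ)) := by
  have hn : HasFDerivAt (fun y : EE m => ‖y‖ ^ 2) ((2 : ℝ) • innerSL ℝ x) x :=
    (hasStrictFDerivAt_norm_sq x).hasFDerivAt.congr_fderiv (by ext; simp)
  have h1 := (quadForm_hasFDerivAt hA x).rpow_const (p := -s) (Or.inl (quadForm_pos hA hx).ne')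
  have h2 := hn.rpow_const (p := -p) (Or.inl (by simpa using hx))
  have hd : DifferentiableAt ℝ HH (‖x‖ ^ 2) :=
    (HH.contDiff (n := 1)).differentiable (by norm_num) _
  have h3 := hd.hasDerivAt.comp_hasFDerivAt x hn
  have h := ((h1.mul h2).mul h3).fderiv
  have e : ff A s p = (fun y : EE m => quadForm A y ^ (-s)) * (fun y => (‖y‖ ^ 2) ^ (-p)) *
     (HH ∘ fun y => ‖y‖ ^ 2) := rfl
  rw [e, h]
  simp
  ring

lemma one_posDef (m : ℕ) : (1 : Matrix (Fin m) (Fin m) ℝ).PosDef := Matrix.PosDef.one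

lemma TT_one {m : ℕ} (x : EE m) : TT 1 x = x := by
  simp [TT, Matrix.toLpLin_apply]

/-- function on the sphere (homogeneous extension) -/
def FF {m : ℕ} (A : Matrix (Fin m) (Fin m) ℝ) (s : ℝ) (x : EE m) : ℝ :=
  A.trace * quadForm A x ^ (-s) - 2 * s * (quadForm A x ^ (-s - 1) * quadForm (A * A) x)
    - (m - 2 * s) * quadForm A x ^ (1 - s)

lemma polar {m : ℕ} (hm : 2 ≤ m) (F : EE m → ℝ) (R : ℝ → ℝ) (g : EE m → ℝ)
    (h : ∀ (θ : sphere (0 : EE m) 1) (r : ℝ), 0 < r → g (r • (θ : EE m)) = F θ * R r) :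
    ∫ x, g x = (∫ θ : sphere (0 : EE m) 1, F θ ∂(volume : Measure (EE m)).toSphere) *
      ∫ r : Set.Ioi (0 : ℝ), R r ∂(Measure.volumeIoiPow (Module.finrank ℝ (EE m) - 1)) := by
  have : Nonempty (Fin m) := ⟨⟨0, by omega⟩⟩
  have : Nontrivial (EE m) := by infer_instance
  rw [← integral_prod_mul (fun θ : sphere (0 : EE m) 1 => F θ) (fun r : Set.Ioi (0:ℝ) => R r)]
  rw [← (volume : Measure (EE m)).measurePreserving_homeomorphUnitSphereProd.integral_comp
        (Homeomorph.measurableEmbedding _)]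
  have h1 : ∫ x, g x = ∫ x : ({(0)}ᶜ : Set (EE m)), g x ∂((volume : Measure (EE m)).comap (↑)) := by
    rw [integral_subtype_comap (measurableSet_singleton _).compl g, restrict_compl_singleton]
  rw [h1]
  congr 1
  ext x
  have hx : (0 : ℝ) < ‖(x : EE m)‖ := norm_pos_iff.2 x.2
  rw [← h _ _ ((homeomorphUnitSphereProd (EE m) x).2.2)]
  congr 1
  simp [smul_smul, hx.ne']

lemma radial_pos {m : ℕ} (hm : 2 ≤ m) (s : ℝ) :
    ∫ r : Set.Ioi (0 : ℝ), ((r : ℝ) ^ 2) ^ (-s) * HH ((r : ℝ) ^ 2)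
      ∂(Measure.volumeIoiPow (Module.finrank ℝ (EE m) - 1)) ≠ 0 := by
  intro h0
  have h := polar (m := m) hm (fun _ => 1) (fun r => (r ^ 2) ^ (-s) * HH (r ^ 2)) (ff 1 0 s) ?_
  · rw [h0, mul_zero] at h
    have hcont := (ff_contDiff (one_posDef m) 0 s).continuous
    have hnn : 0 ≤ ff (1 : Matrix (Fin m) (Fin m) ℝ) 0 s := by
      intro x
      simp only [ff, neg_zero, Real.rpow_zero, one_mul, Pi.zero_apply]
      exact mul_nonneg (by positivity) HH.nonneg
    have hz := (integral_eq_zero_iff_of_nonneg hnn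
      (hcont.integrable_of_hasCompactSupport (ff_support _ _ _))).1 h
    have hz' := (hcont.ae_eq_iff_eq volume continuous_zero).1 hz
    have i0 : Fin m := ⟨0, by omega⟩
    have := congrFun hz' (EuclideanSpace.single i0 (Real.sqrt 2))
    have h1 : HH 2 = 1 := HH.one_of_mem_closedBall (by simp [HH])
    simp [ff, h1] at this
    have : (0:ℝ) < 2 ^ (-s) := by positivity
    linarith
  · intro θ r hr
    have : ‖(θ : EE m)‖ = 1 := by simpa using θ.2
    simp [ff, norm_smul, this]

lemma main_identity {m : ℕ} (hm : 2 ≤ m) {A : Matrix (Fin m) (Fin m) ℝ} (hA : A.PosDef) (s : ℝ) :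
    ∫ θ : sphere (0 : EE m) 1, FF A s θ ∂(volume : Measure (EE m)).toSphere = 0 := by
  have hpolar := polar (m := m) hm (FF A s) (fun r => (r ^ 2) ^ (-s) * HH (r ^ 2))
    (fun x => (A.trace * ff A s 0 x + fderiv ℝ (ff A s 0) x (TT A x))
      - ((1 : Matrix (Fin m) (Fin m) ℝ).trace * ff A (s - 1) 1 x
        + fderiv ℝ (ff A (s - 1) 1) x (TT 1 x))) ?_
  · have hIntg : ∀ (B : Matrix (Fin m) (Fin m) ℝ) (s p : ℝ),
        Integrable (fun x => B.trace * ff A s p x + fderiv ℝ (ff A s p) x (TT B x)) := by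
      intro B s p
      have hf := ff_contDiff hA s p
      have hc := ff_support A s p
      have hf' : Continuous (fderiv ℝ (ff A s p)) := hf.continuous_fderiv (by norm_num)
      have := hf.continuous
      apply Continuous.integrable_of_hasCompactSupport
      · fun_prop
      · apply HasCompactSupport.add hc.mul_left
        apply (hc.fderiv ℝ).mono
        intro x hx h0
        apply hx
        simp [h0]
    rw [integral_sub (hIntg _ _ _) (hIntg _ _ _),
      div_identity A (ff_contDiff hA _ _) (ff_support _ _ _),
      div_identity 1 (ff_contDiff hA _ _) (ff_support _ _ _), sub_zero] at hpolar
    exact (mul_eq_zero.1 hpolar.symm).resolve_right (radial_pos hm s)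
  · intro θ r hr
    have hθ : ‖(θ : EE m)‖ = 1 := by simpa using θ.2
    have hθ0 : (θ : EE m) ≠ 0 := by
      intro h; simp [h] at hθ
    have hq := quadForm_pos hA hθ0
    have hx : r • (θ : EE m) ≠ 0 := smul_ne_zero hr.ne' hθ0
    have hr2 : 0 < r ^ 2 := by positivity
    have hqx := quadForm_pos hA hx
    simp only [ff_fderiv hA _ _ hx, TT_one, ← quadForm_sq hA, real_inner_comm (r • (θ : EE m)) (TT A _),
      ← quadForm_eq, real_inner_self_eq_norm_sq, ff, FF]
    simp only [quadForm_smul, norm_smul, hθ, mul_one, Real.norm_eq_abs, sq_abs, Matrix.trace_one,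
      Fintype.card_fin]
    generalize quadForm A (θ : EE m) = q at *
    generalize quadForm (A * A) (θ : EE m) = a
    generalize r ^ 2 = R at *
    simp only [Real.mul_rpow hr2.le hq.le]
    have e1 : ∀ t : ℝ, 0 < t → t ^ (-(s - 1)) = t ^ (-s) * t := by
      intro t ht
      rw [← Real.rpow_add_one ht.ne']; ring_nf
    have e1' : ∀ t : ℝ, 0 < t → t ^ (1 - s) = t ^ (-s) * t := by
      intro t ht
      rw [← Real.rpow_add_one ht.ne']; ring_nf
    have e2 : ∀ t : ℝ, 0 < t → t ^ (-(s - 1) - 1) = t ^ (-s) := by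
      intro t ht
      ring_nf
    have e3 : ∀ t : ℝ, 0 < t → t ^ (-s - 1) = t ^ (-s) / t := by
      intro t ht
      rw [Real.rpow_sub_one ht.ne']
    have e4 : R ^ (-1 - 1 : ℝ) = R⁻¹ * R⁻¹ := by
      rw [Real.rpow_sub_one hr2.ne', Real.rpow_neg_one]; rfl
    simp only [e1 _ hq, e1 _ hr2, e1' _ hq, e2 _ hq, e2 _ hr2, e3 _ hq, e3 _ hr2, e4, neg_zero,
      Real.rpow_zero, Real.rpow_neg_one]
    field_simp
    ring

end SphereAux

open SphereAux in
/-- for every `m ≥ 2`, every symmetric positive definite `m×m` real matrix `A`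
and every `β ∈ ℝ`, `2(1+β) ∫_{S^{m-1}} ⟨θ,A²θ⟩/⟨θ,Aθ⟩ μ_{A,β}(dθ) < tr(A) ↔ β < m/2 - 1`. -/
theorem statement4 {m : ℕ} (hm : 2 ≤ m) (A : Matrix (Fin m) (Fin m) ℝ)
    (hA : A.PosDef) (β : ℝ) :
    2 * (1 + β) *
        (∫ θ : sphere (0 : EuclideanSpace ℝ (Fin m)) 1,
          quadForm (A * A) ↑θ / quadForm A ↑θ ∂(muAB A β)) < A.trace ↔
      β < (m : ℝ) / 2 - 1 := by
  set s := 1 + β with hs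
  haveI : Nonempty (Fin m) := ⟨⟨0, by omega⟩⟩
  haveI : Nontrivial (EuclideanSpace ℝ (Fin m)) := by
    infer_instance
  set τ := (volume : Measure (EuclideanSpace ℝ (Fin m))).toSphere with hτ
  have hτ0 : τ Set.univ ≠ 0 := by
    rw [Ne, Measure.measure_univ_eq_zero]; exact Measure.toSphere_ne_zero _
  have hθ0 : ∀ θ : sphere (0 : EuclideanSpace ℝ (Fin m)) 1,
      (θ : EuclideanSpace ℝ (Fin m)) ≠ 0 := by
    intro θ h
    have := θ.2
    simp [h] at this
  have hq : ∀ θ : sphere (0 : EuclideanSpace ℝ (Fin m)) 1,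
      0 < quadForm A (θ : EuclideanSpace ℝ (Fin m)) := fun θ => quadForm_pos hA (hθ0 θ)
  have hqc : ∀ B : Matrix (Fin m) (Fin m) ℝ,
      Continuous fun θ : sphere (0 : EuclideanSpace ℝ (Fin m)) 1 =>
        quadForm B (θ : EuclideanSpace ℝ (Fin m)) :=
    fun B => (quadForm_contDiff B).continuous.comp continuous_subtype_val
  have hpc : ∀ t : ℝ, Continuous fun θ : sphere (0 : EuclideanSpace ℝ (Fin m)) 1 =>
        quadForm A (θ : EuclideanSpace ℝ (Fin m)) ^ t :=
    fun t => (hqc A).rpow_const fun θ => Or.inl (hq θ).ne'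
  have hIntg : ∀ g : sphere (0 : EuclideanSpace ℝ (Fin m)) 1 → ℝ, Continuous g →
      Integrable g τ := fun g hg =>
    hg.integrable_of_hasCompactSupport (HasCompactSupport.of_compactSpace g)
  set k : ℝ := ((τ Set.univ)⁻¹).toReal with hk
  have hkpos : 0 < k := by
    apply ENNReal.toReal_pos
    · simp
    · simpa using hτ0
  have hσ : ∀ g : sphere (0 : EuclideanSpace ℝ (Fin m)) 1 → ℝ,
      ∫ θ, g θ ∂(sphereUniform m) = k * ∫ θ, g θ ∂τ := by
    intro g
    rw [sphereUniform, integral_smul_measure, smul_eq_mul]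
  have hI : ∀ t : ℝ, 0 < ∫ θ : sphere (0 : EuclideanSpace ℝ (Fin m)) 1,
      quadForm A (θ : EuclideanSpace ℝ (Fin m)) ^ t ∂τ := by
    intro t
    rw [integral_pos_iff_support_of_nonneg (fun θ => (Real.rpow_pos_of_pos (hq θ) t).le)
      (hIntg _ (hpc t))]
    have : (Function.support fun θ : sphere (0 : EuclideanSpace ℝ (Fin m)) 1 =>
      quadForm A (θ : EuclideanSpace ℝ (Fin m)) ^ t) = Set.univ := by
      ext θ; simpa using (Real.rpow_pos_of_pos (hq θ) t).ne'
    rw [this]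
    exact pos_iff_ne_zero.2 hτ0
  have hZ : Zfun A s = k * ∫ θ : sphere (0 : EuclideanSpace ℝ (Fin m)) 1,
      quadForm A (θ : EuclideanSpace ℝ (Fin m)) ^ (-s) ∂τ := hσ _
  have hZpos : 0 < Zfun A s := by rw [hZ]; exact mul_pos hkpos (hI _)
  have hmu : ∫ θ : sphere (0 : EuclideanSpace ℝ (Fin m)) 1,
          quadForm (A * A) ↑θ / quadForm A ↑θ ∂(muAB A β) =
      (k / Zfun A s) * ∫ θ : sphere (0 : EuclideanSpace ℝ (Fin m)) 1,
        quadForm A (θ : EuclideanSpace ℝ (Fin m)) ^ (-s - 1) *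
          quadForm (A * A) (θ : EuclideanSpace ℝ (Fin m)) ∂τ := by
    rw [muAB, integral_withDensity_eq_integral_toReal_smul, hσ, div_mul_eq_mul_div,
      mul_div_assoc, ← integral_div]
    · congr 2
      ext θ
      rw [ENNReal.toReal_ofReal (div_nonneg (Real.rpow_pos_of_pos (hq θ) _).le hZpos.le),
        Real.rpow_sub_one (hq θ).ne', smul_eq_mul, ← hs]
      ring
    · exact ((hpc _).div_const _).measurable.ennreal_ofReal
    · exact Eventually.of_forall fun _ => ENNReal.ofReal_lt_top
  have hmain := main_identity hm hA s
  rw [← hτ] at hmain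
  simp only [FF] at hmain
  have c1 := hIntg _ ((hpc (-s)).const_mul A.trace)
  have c2 : Integrable (fun θ : sphere (0 : EuclideanSpace ℝ (Fin m)) 1 =>
      2 * s * (quadForm A (θ : EuclideanSpace ℝ (Fin m)) ^ (-s - 1) *
        quadForm (A * A) (θ : EuclideanSpace ℝ (Fin m)))) τ :=
    hIntg _ (((hpc (-s - 1)).mul (hqc (A * A))).const_mul (2 * s))
  have c12 : Integrable (fun θ : sphere (0 : EuclideanSpace ℝ (Fin m)) 1 =>
      A.trace * quadForm A (θ : EuclideanSpace ℝ (Fin m)) ^ (-s) -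
      2 * s * (quadForm A (θ : EuclideanSpace ℝ (Fin m)) ^ (-s - 1) *
        quadForm (A * A) (θ : EuclideanSpace ℝ (Fin m)))) τ := c1.sub c2
  have c3 := hIntg _ ((hpc (1 - s)).const_mul ((m : ℝ) - 2 * s))
  rw [integral_sub c12 c3, integral_sub c1 c2, integral_const_mul, integral_const_mul,
    integral_const_mul] at hmain
  rw [hmu, hZ]
  have p1 := hI (-s)
  have p2 := hI (1 - s)
  generalize (∫ θ : sphere (0 : EuclideanSpace ℝ (Fin m)) 1,
      quadForm A (θ : EuclideanSpace ℝ (Fin m)) ^ (-s) ∂τ) = I1 at *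
  generalize (∫ θ : sphere (0 : EuclideanSpace ℝ (Fin m)) 1,
      quadForm A (θ : EuclideanSpace ℝ (Fin m)) ^ (1 - s) ∂τ) = I2 at *
  generalize (∫ θ : sphere (0 : EuclideanSpace ℝ (Fin m)) 1,
        quadForm A (θ : EuclideanSpace ℝ (Fin m)) ^ (-s - 1) *
          quadForm (A * A) (θ : EuclideanSpace ℝ (Fin m)) ∂τ) = I3 at *
  have e : 2 * s * (k / (k * I1) * I3) = A.trace - ((m : ℝ) - 2 * s) * (I2 / I1) := by
    have : 2 * s * I3 = A.trace * I1 - ((m : ℝ) - 2 * s) * I2 := by linarith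
    field_simp
    linarith
  rw [e]
  have hr : 0 < I2 / I1 := div_pos p2 p1
  constructor
  · intro h
    have : 0 < ((m : ℝ) - 2 * s) * (I2 / I1) := by linarith
    have := pos_of_mul_pos_left this hr.le
    linarith
  · intro h
    have : 0 < ((m : ℝ) - 2 * s) * (I2 / I1) := mul_pos (by linarith) hr
    linarith
end
end

section
/- Let m ≥ 2, let U : ℝ^m → ℝ be twice continuously differentiable with U(0) = 0 and ∇U(0) = 0, let A be the Hessian of U at 0, and let β ∈ ℝ. Define, for x ≠ 0, H_β(x) := (β⟨∇U(x),x⟩ − (m−2)U(x))/‖x‖² (this is the value of the operator f ↦ U·Δf − β⟨∇U,∇f⟩ applied to the function x ↦ −ln‖x‖). Then H_β(ρθ) converges to (β − (m/2 − 1))⟨θ,Aθ⟩ as ρ → 0+, uniformly over θ in the unit sphere S^{m-1}; that is, sup_{θ ∈ S^{m-1}} |H_β(ρθ) − (β − (m/2 − 1))⟨θ,Aθ⟩| → 0 as ρ → 0+. -/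
open Metric Filter
open scoped InnerProductSpace RealInnerProductSpace Topology

noncomputable section

theorem aux_bound {m : ℕ} (U : EuclideanSpace ℝ (Fin m) → ℝ)
    (hU : ContDiff ℝ 2 U) (hU0 : U 0 = 0) (hgrad0 : gradient U 0 = 0)
    (T : EuclideanSpace ℝ (Fin m) →L[ℝ] EuclideanSpace ℝ (Fin m))
    (hT : T = fderiv ℝ (gradient U) 0)
    (hsym : ∀ x y, ⟪T x, y⟫_ℝ = ⟪x, T y⟫_ℝ) (ε : ℝ) (hε : 0 < ε) :
    ∃ δ > 0, ∀ x, ‖x‖ < δ → ‖gradient U x - T x‖ ≤ ε * ‖x‖ ∧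
      |U x - 1 / 2 * ⟪x, T x⟫_ℝ| ≤ ε * ‖x‖ ^ 2 := by
  have hd : Differentiable ℝ U := hU.differentiable (by norm_num)
  have hG : ContDiff ℝ 1 (gradient U) := by
    have h1 : ContDiff ℝ 1 (fderiv ℝ U) := hU.fderiv_right (by norm_num)
    exact (InnerProductSpace.toDual ℝ
      (EuclideanSpace ℝ (Fin m))).symm.toContinuousLinearEquiv.contDiff.comp h1
  have hGd : HasFDerivAt (gradient U) T 0 := by
    rw [hT]
    exact (hG.differentiable (by norm_num) 0).hasFDerivAt
  have hlo := hGd.isLittleO.def hε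
  simp only [hgrad0, sub_zero] at hlo
  obtain ⟨δ, hδ, hb⟩ := Metric.eventually_nhds_iff.1 hlo
  have hb' : ∀ x, ‖x‖ < δ → ‖gradient U x - T x‖ ≤ ε * ‖x‖ := by
    intro x hx
    exact hb (by simpa using hx)
  refine ⟨δ, hδ, fun x hx => ⟨hb' x hx, ?_⟩⟩
  have hder : ∀ y, HasFDerivAt (fun y => U y - 1 / 2 * ⟪y, T y⟫_ℝ)
      (InnerProductSpace.toDual ℝ (EuclideanSpace ℝ (Fin m)) (gradient U y - T y)) y := by
    intro y
    have h1 := (hd y).hasGradientAt.hasFDerivAt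
    have h2 := ((hasFDerivAt_id (𝕜 := ℝ) y).inner ℝ (T.hasFDerivAt (x := y))).const_mul (1/2 : ℝ)
    refine (h1.sub h2).congr_fderiv ?_
    ext v
    have h3 := hsym y v
    have h4 := real_inner_comm v (T y)
    simp [inner_sub_left]
    linarith
  have hmv := (convex_closedBall (0 : EuclideanSpace ℝ (Fin m)) ‖x‖).norm_image_sub_le_of_norm_hasFDerivWithin_le
    (f := fun y => U y - 1 / 2 * ⟪y, T y⟫_ℝ) (C := ε * ‖x‖) (x := 0) (y := x)
    (fun y _ => (hder y).hasFDerivWithinAt) (by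
      intro y hy
      have hy' : ‖y‖ ≤ ‖x‖ := by simpa using hy
      rw [LinearIsometryEquiv.norm_map]
      exact (hb' y (hy'.trans_lt hx)).trans (by gcongr)) (by simp) (by simp)
  simp only [hU0, map_zero, inner_zero_left, mul_zero, sub_zero, Real.norm_eq_abs] at hmv
  calc _ ≤ _ := hmv
    _ = _ := by ring

/-- if `U : ℝ^m → ℝ` (`m ≥ 2`) is `C²` with `U(0) = 0`, `∇U(0) = 0`, Hessian `A`
at `0`, and `β ∈ ℝ`, then `H_β(x) := (β⟨∇U(x),x⟩ − (m−2)U(x))/‖x‖²` satisfies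
`H_β(ρθ) → (β − (m/2 − 1))⟨θ,Aθ⟩` as `ρ → 0⁺`, uniformly in `θ ∈ S^{m-1}`. -/
theorem statement8 {m : ℕ} (hm : 2 ≤ m) (U : EuclideanSpace ℝ (Fin m) → ℝ)
    (hU : ContDiff ℝ 2 U) (hU0 : U 0 = 0) (hgrad0 : gradient U 0 = 0)
    (A : Matrix (Fin m) (Fin m) ℝ) (hAsymm : A.IsSymm)
    (hA : ∀ v, fderiv ℝ (gradient U) 0 v = Matrix.toEuclideanLin A v) (β : ℝ) :
    TendstoUniformlyOn
      (fun ρ : ℝ => fun θ : EuclideanSpace ℝ (Fin m) =>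
        (β * ⟪gradient U (ρ • θ), ρ • θ⟫_ℝ - ((m : ℝ) - 2) * U (ρ • θ)) / ‖ρ • θ‖ ^ 2)
      (fun θ => (β - ((m : ℝ) / 2 - 1)) * ⟪θ, Matrix.toEuclideanLin A θ⟫_ℝ)
      (𝓝[>] (0 : ℝ)) (sphere (0 : EuclideanSpace ℝ (Fin m)) 1) := by
  have hTA : ∀ v, Matrix.toEuclideanLin A v = fderiv ℝ (gradient U) 0 v := fun v => (hA v).symm
  have hherm : A.IsHermitian := by
    rw [Matrix.IsHermitian, Matrix.conjTranspose_eq_transpose_of_trivial]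
    exact hAsymm
  have hs := Matrix.isSymmetric_toEuclideanLin_iff.2 hherm
  simp only [hTA]
  have hsym : ∀ x y, ⟪fderiv ℝ (gradient U) 0 x, y⟫_ℝ = ⟪x, fderiv ℝ (gradient U) 0 y⟫_ℝ := by
    intro x y
    rw [hA, hA]
    exact hs x y
  clear hTA
  obtain ⟨T, hT⟩ : ∃ T, T = fderiv ℝ (gradient U) 0 := ⟨_, rfl⟩
  rw [← hT] at hsym ⊢
  rw [Metric.tendstoUniformlyOn_iff]
  intro ε hε
  set K : ℝ := |β| + |(m : ℝ) - 2| + 1 with hK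
  have hKpos : 0 < K := by positivity
  obtain ⟨δ, hδ, hb⟩ := aux_bound U hU hU0 hgrad0 T hT hsym (ε / K) (by positivity)
  filter_upwards [Ioo_mem_nhdsGT hδ] with ρ hρ θ hθ
  have hρ0 : 0 < ρ := hρ.1
  have hθ1 : ‖θ‖ = 1 := by simpa using hθ
  have hn : ‖ρ • θ‖ = ρ := by rw [norm_smul, hθ1, mul_one, Real.norm_of_nonneg hρ0.le]
  obtain ⟨h1, h2⟩ := hb (ρ • θ) (by rw [hn]; exact hρ.2)
  have hq : ⟪ρ • θ, T (ρ • θ)⟫_ℝ = ρ ^ 2 * ⟪θ, T θ⟫_ℝ := by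
    rw [map_smul, real_inner_smul_left, real_inner_smul_right]; ring
  have h3 : |⟪gradient U (ρ • θ), ρ • θ⟫_ℝ - ρ ^ 2 * ⟪θ, T θ⟫_ℝ| ≤ ε / K * ρ ^ 2 := by
    rw [← hq, ← hsym, ← inner_sub_left]
    refine (abs_real_inner_le_norm _ _).trans ?_
    rw [hn] at h1 ⊢
    nlinarith
  rw [hq, hn] at h2
  rw [hn, dist_comm, Real.dist_eq]
  generalize ⟪gradient U (ρ • θ), ρ • θ⟫_ℝ = a at *
  generalize U (ρ • θ) = u at *
  generalize ⟪θ, T θ⟫_ℝ = q at *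
  have e : (β * a - ((m : ℝ) - 2) * u) / ρ ^ 2 - (β - ((m : ℝ) / 2 - 1)) * q
      = (β * (a - ρ ^ 2 * q) - ((m : ℝ) - 2) * (u - 1 / 2 * (ρ ^ 2 * q))) / ρ ^ 2 := by
    field_simp
    ring
  rw [e, abs_div, abs_of_pos (show 0 < ρ ^ 2 by positivity), div_lt_iff₀ (by positivity)]
  calc _ ≤ |β * (a - ρ ^ 2 * q)| + |((m : ℝ) - 2) * (u - 1 / 2 * (ρ ^ 2 * q))| := abs_sub _ _
    _ ≤ |β| * (ε / K * ρ ^ 2) + |(m : ℝ) - 2| * (ε / K * ρ ^ 2) := by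
      rw [abs_mul, abs_mul]; gcongr
    _ < K * (ε / K * ρ ^ 2) := by
      have : 0 < ε / K * ρ ^ 2 := by positivity
      rw [hK] at this ⊢
      nlinarith
    _ = ε * ρ ^ 2 := by field_simp
end
end

section
/- Let Ω ⊆ ℝ^m be open, let U : Ω → ℝ be continuously differentiable with U > 0 on Ω, let f : Ω → ℝ be twice continuously differentiable with compact support contained in Ω, and let β ∈ ℝ. Then ∫_Ω (U(x)Δf(x) − β⟨∇U(x),∇f(x)⟩) U(x)^{−1−β} dx = 0, where dx denotes Lebesgue measure; that is, the measure with density U^{−1−β} with respect to Lebesgue measure annihilates L_β f for every compactly supported C² function f, where L_β f := U·Δf − β⟨∇U,∇f⟩. -/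
open Metric Filter MeasureTheory
open scoped InnerProductSpace RealInnerProductSpace Topology

noncomputable section

/-- The Euclidean Laplacian `Δf(x) = ∑ᵢ ∂²f/∂xᵢ²(x)` of `f : ℝ^m → ℝ`. -/
def laplacian {m : ℕ} (f : EuclideanSpace ℝ (Fin m) → ℝ)
    (x : EuclideanSpace ℝ (Fin m)) : ℝ :=
  ∑ i : Fin m,
    fderiv ℝ (fun y => fderiv ℝ f y (EuclideanSpace.single i (1 : ℝ))) x
      (EuclideanSpace.single i (1 : ℝ))

/-- The Euclidean divergence `div F(x) = ∑ᵢ ∂Fᵢ/∂xᵢ(x)` of a vector field `F : ℝ^m → ℝ^m`. -/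
def diverg {m : ℕ} (F : EuclideanSpace ℝ (Fin m) → EuclideanSpace ℝ (Fin m))
    (x : EuclideanSpace ℝ (Fin m)) : ℝ :=
  ∑ i : Fin m, ⟪fderiv ℝ F x (EuclideanSpace.single i (1 : ℝ)),
    EuclideanSpace.single i (1 : ℝ)⟫_ℝ

lemma aux_integral_fderiv {m : ℕ} (G : EuclideanSpace ℝ (Fin m) → ℝ) (hG : ContDiff ℝ 1 G)
    (hc : HasCompactSupport G) (v : EuclideanSpace ℝ (Fin m)) :
    Integrable (fun x => fderiv ℝ G x v) ∧ ∫ x, fderiv ℝ G x v = 0 := by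
  have hi : Integrable (fun x => fderiv ℝ G x v) :=
    Continuous.integrable_of_hasCompactSupport
      ((hG.continuous_fderiv one_ne_zero).clm_apply continuous_const) (hc.fderiv_apply ℝ v)
  refine ⟨hi, ?_⟩
  have := integral_mul_fderiv_eq_neg_fderiv_mul_of_integrable (μ := volume) (𝕜 := ℝ)
    (f := fun _ : EuclideanSpace ℝ (Fin m) => (1 : ℝ)) (g := G) (v := v)
    (by simp) (by simpa using hi)
    (by simpa using hG.continuous.integrable_of_hasCompactSupport hc)
    (by fun_prop) (fun x _ => hG.differentiable one_ne_zero x)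
  simpa using this

lemma aux_inner {m : ℕ} (U f : EuclideanSpace ℝ (Fin m) → ℝ) (x : EuclideanSpace ℝ (Fin m)) :
    ⟪gradient U x, gradient f x⟫_ℝ = ∑ i : Fin m, fderiv ℝ U x (EuclideanSpace.single i (1 : ℝ)) *
      fderiv ℝ f x (EuclideanSpace.single i (1 : ℝ)) := by
  have h := (EuclideanSpace.basisFun (Fin m) ℝ).sum_inner_mul_inner (gradient U x) (gradient f x)
  rw [← h]
  refine Finset.sum_congr rfl fun i _ => ?_
  rw [real_inner_comm (gradient f x)]
  simp only [EuclideanSpace.basisFun_apply]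
  simp only [gradient, InnerProductSpace.toDual_symm_apply]

/-- on an open set `Ω ⊆ ℝ^m` where `U > 0` is `C¹`, for every `C²` function `f`
with compact support contained in `Ω` and every `β ∈ ℝ`,
`∫_Ω (UΔf − β⟨∇U,∇f⟩) U^{−1−β} dx = 0`. -/
theorem statement12 {m : ℕ} (Ω : Set (EuclideanSpace ℝ (Fin m))) (hΩ : IsOpen Ω)
    (U f : EuclideanSpace ℝ (Fin m) → ℝ) (hU : ContDiffOn ℝ 1 U Ω)
    (hUpos : ∀ x ∈ Ω, 0 < U x) (hf : ContDiffOn ℝ 2 f Ω)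
    (hsupp : IsCompact (tsupport f)) (hsuppΩ : tsupport f ⊆ Ω) (β : ℝ) :
    ∫ x in Ω,
        (U x * laplacian f x - β * ⟪gradient U x, gradient f x⟫_ℝ) *
          U x ^ (-1 - β) = 0 := by
  set G : Fin m → EuclideanSpace ℝ (Fin m) → ℝ := fun i x =>
    U x ^ (-β) * fderiv ℝ f x (EuclideanSpace.single i (1 : ℝ)) with hGdef
  have hout : ∀ x ∉ tsupport f, f =ᶠ[𝓝 x] fun _ => 0 := fun x hx =>
    notMem_tsupport_iff_eventuallyEq.mp hx
  have hfd : ∀ x ∉ tsupport f, fderiv ℝ f =ᶠ[𝓝 x] fun _ => 0 := by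
    intro x hx
    have := (hout x hx).fderiv (𝕜 := ℝ)
    filter_upwards [this] with y hy
    simpa using hy
  have hGout : ∀ i, ∀ x ∉ tsupport f, G i =ᶠ[𝓝 x] fun _ => 0 := by
    intro i x hx
    filter_upwards [hfd x hx] with y hy
    simp [hGdef, hy]
  have hUat : ∀ x ∈ Ω, ContDiffAt ℝ 1 U x := fun x hx => hU.contDiffAt (hΩ.mem_nhds hx)
  have hfat : ∀ x ∈ Ω, ∀ i : Fin m, ContDiffAt ℝ 1
      (fun y => fderiv ℝ f y (EuclideanSpace.single i (1 : ℝ))) x := fun x hx i =>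
    ((hf.contDiffAt (hΩ.mem_nhds hx)).fderiv_right (m := 1) (by norm_num)).clm_apply
      contDiffAt_const
  have hG : ∀ i, ContDiff ℝ 1 (G i) := by
    intro i
    rw [contDiff_iff_contDiffAt]
    intro x
    by_cases hx : x ∈ tsupport f
    · have hx' := hsuppΩ hx
      exact ((hUat x hx').rpow_const_of_ne (hUpos x hx').ne').mul (hfat x hx' i)
    · exact contDiffAt_const.congr_of_eventuallyEq (hGout i x hx)
  have hGc : ∀ i, HasCompactSupport (G i) := by
    intro i
    refine HasCompactSupport.intro hsupp fun x hx => ?_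
    exact (hGout i x hx).self_of_nhds
  have key : ∀ x, (U x * laplacian f x - β * ⟪gradient U x, gradient f x⟫_ℝ) *
          U x ^ (-1 - β) = ∑ i, fderiv ℝ (G i) x (EuclideanSpace.single i (1 : ℝ)) := by
    intro x
    rw [aux_inner]
    unfold laplacian
    by_cases hx : x ∈ tsupport f
    · have hx' := hsuppΩ hx
      have hp := hUpos x hx'
      rw [Finset.mul_sum, Finset.mul_sum, ← Finset.sum_sub_distrib, Finset.sum_mul]
      refine Finset.sum_congr rfl fun i _ => ?_
      have h1 : HasFDerivAt (fun y => U y ^ (-β)) ((-β * U x ^ (-β - 1)) • fderiv ℝ U x) x :=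
        ((hUat x hx').differentiableAt one_ne_zero).hasFDerivAt.rpow_const (Or.inl hp.ne')
      have h2 := h1.mul ((hfat x hx' i).differentiableAt one_ne_zero).hasFDerivAt
      have h3 : fderiv ℝ (G i) x = _ := h2.fderiv
      rw [h3]
      have e1 : U x ^ (-β) = U x * U x ^ (-1 - β) := by
        rw [show -β = 1 + (-1 - β) by ring, Real.rpow_add hp, Real.rpow_one]
      rw [e1, show -β - 1 = -1 - β by ring]
      simp only [ContinuousLinearMap.add_apply, ContinuousLinearMap.smul_apply, smul_eq_mul]
      ring
    · have a1 : ∀ i, fderiv ℝ (G i) x = 0 := fun i => by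
        rw [(hGout i x hx).fderiv_eq]; simp
      have a2 : ∀ i : Fin m, fderiv ℝ
          (fun y => fderiv ℝ f y (EuclideanSpace.single i (1 : ℝ))) x = 0 := fun i => by
        have : (fun y => fderiv ℝ f y (EuclideanSpace.single i (1 : ℝ))) =ᶠ[𝓝 x] fun _ => 0 := by
          filter_upwards [hfd x hx] with y hy
          simp [hy]
        rw [this.fderiv_eq]; simp
      simp [a1, a2, (hfd x hx).self_of_nhds]
  rw [setIntegral_eq_integral_of_forall_compl_eq_zero]
  · simp_rw [key]
    rw [integral_finsetSum _ fun i _ => (aux_integral_fderiv (G i) (hG i) (hGc i) _).1]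
    exact Finset.sum_eq_zero fun i _ => (aux_integral_fderiv (G i) (hG i) (hGc i) _).2
  · intro x hx
    rw [key]
    refine Finset.sum_eq_zero fun i _ => ?_
    rw [(hGout i x fun h => hx (hsuppΩ h)).fderiv_eq]; simp
end
end

section
/- Let m ≥ 2 and let U : ℝ^m → ℝ be twice continuously differentiable with U(0) = 0, ∇U(0) = 0, and Hessian of U at 0 positive definite. Then there exists ε > 0 such that U > 0 on the punctured ball B(0,ε) \ {0} and, for every β ∈ ℝ, the integral ∫_{B(0,ε)\{0}} U(x)^{−(1+β)} dx (with respect to Lebesgue measure) is finite if and only if β < m/2 − 1. -/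
open Metric Filter MeasureTheory
open scoped InnerProductSpace RealInnerProductSpace Topology

noncomputable section

lemma posdef_coercive {m : ℕ} (hm : 2 ≤ m) (A : Matrix (Fin m) (Fin m) ℝ) (hApos : A.PosDef) :
    ∃ c > (0 : ℝ), ∀ v : EuclideanSpace ℝ (Fin m),
      c * ‖v‖ ^ 2 ≤ ⟪Matrix.toEuclideanLin A v, v⟫_ℝ := by
  have : Nonempty (Fin m) := ⟨⟨0, by omega⟩⟩
  have hne : (sphere (0 : EuclideanSpace ℝ (Fin m)) 1).Nonempty :=
    NormedSpace.sphere_nonempty.2 zero_le_one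
  have hcL : Continuous (Matrix.toEuclideanLin A) := LinearMap.continuous_of_finiteDimensional _
  obtain ⟨w, hw, hmin⟩ := (isCompact_sphere (0 : EuclideanSpace ℝ (Fin m)) 1).exists_isMinOn hne
    (f := fun v => ⟪Matrix.toEuclideanLin A v, v⟫_ℝ) (by fun_prop)
  have hpos : ∀ v : EuclideanSpace ℝ (Fin m), v ≠ 0 → 0 < ⟪Matrix.toEuclideanLin A v, v⟫_ℝ := by
    intro v hv
    have h := hApos.dotProduct_mulVec_pos (x := v.ofLp) (by simpa using hv)
    simpa [EuclideanSpace.inner_eq_star_dotProduct, Matrix.toLpLin_apply] using h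
  refine ⟨_, hpos w (ne_of_mem_sphere hw one_ne_zero), fun v => ?_⟩
  by_cases hv : v = 0
  · simp [hv]
  have hn : ‖v‖ ≠ 0 := by simpa using hv
  have h1 : (‖v‖⁻¹ • v) ∈ sphere (0 : EuclideanSpace ℝ (Fin m)) 1 := by
    simp [norm_smul, hn]
  have h2 := hmin h1
  simp only [Set.mem_setOf_eq, map_smul, inner_smul_left, inner_smul_right] at h2
  simp only [conj_trivial] at h2
  calc _ ≤ (‖v‖⁻¹ * (‖v‖⁻¹ * ⟪Matrix.toEuclideanLin A v, v⟫_ℝ)) * ‖v‖ ^ 2 := by gcongr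
    _ = _ := by field_simp

lemma two_sided {m : ℕ} (hm : 2 ≤ m) (U : EuclideanSpace ℝ (Fin m) → ℝ)
    (hU : ContDiff ℝ 2 U) (hU0 : U 0 = 0) (hgrad0 : gradient U 0 = 0)
    (A : Matrix (Fin m) (Fin m) ℝ) (hApos : A.PosDef)
    (hA : ∀ v, fderiv ℝ (gradient U) 0 v = Matrix.toEuclideanLin A v) :
    ∃ ε > (0 : ℝ), ∃ a > (0 : ℝ), ∃ b > (0 : ℝ), ∀ x : EuclideanSpace ℝ (Fin m), ‖x‖ < ε →
      a * ‖x‖ ^ 2 ≤ U x ∧ U x ≤ b * ‖x‖ ^ 2 := by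
  obtain ⟨c, hc, hcoer⟩ := posdef_coercive hm A hApos
  have hG : DifferentiableAt ℝ (gradient U) 0 := by
    have h1 : ContDiff ℝ 1 (fderiv ℝ U) := hU.fderiv_right (by norm_num)
    have h2 : Differentiable ℝ (fderiv ℝ U) := h1.differentiable (by norm_num)
    exact ((InnerProductSpace.toDual ℝ (EuclideanSpace ℝ (Fin m))).symm.toContinuousLinearEquiv.differentiable _).comp _ (h2 0)
  have hlo := hG.hasFDerivAt.isLittleO
  have hb := hlo.def (half_pos hc)
  obtain ⟨ε, hε, hball⟩ := Metric.eventually_nhds_iff.1 hb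
  set L := fderiv ℝ (gradient U) 0 with hL
  have key : ∀ y : EuclideanSpace ℝ (Fin m), ‖y‖ < ε →
      (c / 2) * ‖y‖ ^ 2 ≤ ⟪gradient U y, y⟫_ℝ ∧
      ⟪gradient U y, y⟫_ℝ ≤ (‖L‖ + c / 2) * ‖y‖ ^ 2 := by
    intro y hy
    have h := hball (y := y) (by simpa using hy)
    simp only [hgrad0, sub_zero] at h
    have h3 : |⟪gradient U y - L y, y⟫_ℝ| ≤ c / 2 * ‖y‖ ^ 2 :=
      (abs_real_inner_le_norm _ _).trans (by rw [pow_two, ← mul_assoc]; gcongr)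
    rw [inner_sub_left] at h3
    have h4 := hcoer y
    rw [← hA] at h4
    have h5 : ⟪L y, y⟫_ℝ ≤ ‖L‖ * ‖y‖ ^ 2 :=
      (real_inner_le_norm _ _).trans (by rw [pow_two, ← mul_assoc]; gcongr; exact L.le_opNorm y)
    have := abs_le.1 h3
    constructor <;> nlinarith
  refine ⟨ε, hε, c / 4, by positivity, (‖L‖ + c / 2) / 2, by positivity, fun x hx => ?_⟩
  have hd : ∀ t : ℝ, HasDerivAt (fun t : ℝ => U (t • x)) ⟪gradient U (t • x), x⟫_ℝ t := by
    intro t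
    have h1 : HasFDerivAt U (fderiv ℝ U (t • x)) (t • x) :=
      (hU.differentiable (by norm_num) _).hasFDerivAt
    have h2 : HasDerivAt (fun t : ℝ => t • x) x t := by
      simpa using (hasDerivAt_id t).smul_const x
    have h3 := h1.comp_hasDerivAt t h2
    rw [inner_gradient_left]
    exact h3
  have hsq : ∀ t : ℝ, HasDerivAt (fun t : ℝ => t ^ 2) (2 * t) t := fun t => by
    simpa using hasDerivAt_pow 2 t
  obtain ⟨t, ⟨ht0, ht1⟩, ht⟩ := exists_ratio_hasDerivAt_eq_ratio_slope
    (fun t : ℝ => U (t • x)) _ (zero_lt_one)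
    (fun t _ => (hd t).continuousAt.continuousWithinAt) (fun t _ => hd t)
    (fun t : ℝ => t ^ 2) _ (fun t _ => (hsq t).continuousAt.continuousWithinAt) (fun t _ => hsq t)
  simp [hU0] at ht
  have hk := key (t • x) (by
    rw [norm_smul, Real.norm_of_nonneg ht0.le]
    nlinarith [norm_nonneg x])
  rw [inner_smul_right, norm_smul, Real.norm_of_nonneg ht0.le, inner_gradient_left] at hk
  have ht2 : 0 < t ^ 2 := by positivity
  constructor
  · refine le_of_mul_le_mul_left ?_ ht2
    nlinarith
  · refine le_of_mul_le_mul_left ?_ ht2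
    nlinarith

lemma rpow_integrable_iff {m : ℕ} (hm : 2 ≤ m) {ε : ℝ} (hε : 0 < ε) (p : ℝ) :
    IntegrableOn (fun x : EuclideanSpace ℝ (Fin m) => ‖x‖ ^ p) (ball 0 ε) volume ↔
      -(m : ℝ) < p := by
  have : Nonempty (Fin m) := ⟨⟨0, by omega⟩⟩
  rw [integrableOn_fun_norm_addHaar volume (f := fun y : ℝ => y ^ p)]
  have h : IntegrableOn (fun y : ℝ => y ^ (Module.finrank ℝ (EuclideanSpace ℝ (Fin m)) - 1) • y ^ p)
      (Set.Ioo 0 ε) ↔ IntegrableOn (fun y : ℝ => y ^ ((m : ℝ) - 1 + p)) (Set.Ioo 0 ε) := by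
    apply integrableOn_congr_fun _ measurableSet_Ioo
    intro y hy
    simp only [finrank_euclideanSpace_fin, smul_eq_mul]
    rw [← Real.rpow_natCast, ← Real.rpow_add hy.1, Nat.cast_sub (by omega)]
    simp
  rw [h, intervalIntegral.integrableOn_Ioo_rpow_iff hε]
  constructor <;> intro <;> linarith

/-- Comparison of powers of comparable positive quantities. -/
lemma rpow_compare {a b u r : ℝ} (ha : 0 < a) (hb : 0 < b) (hr : 0 < r)
    (h1 : a * r ^ 2 ≤ u) (h2 : u ≤ b * r ^ 2) (s : ℝ) :
    u ^ s ≤ (a ^ s + b ^ s) * r ^ (2 * s) ∧ r ^ (2 * s) ≤ (a ^ (-s) + b ^ (-s)) * u ^ s := by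
  have hu : 0 < u := lt_of_lt_of_le (by positivity) h1
  have hrr : (r ^ 2) ^ s = r ^ (2 * s) := by
    rw [Real.rpow_mul hr.le]; norm_num
  have hrs : 0 < r ^ (2 * s) := by positivity
  have has : 0 < a ^ s := by positivity
  have hbs : 0 < b ^ s := by positivity
  have hus : 0 < u ^ s := by positivity
  rw [Real.rpow_neg ha.le, Real.rpow_neg hb.le]
  have e1 : (a * r ^ 2) ^ s = a ^ s * r ^ (2 * s) := by
    rw [Real.mul_rpow ha.le (by positivity), hrr]
  have e2 : (b * r ^ 2) ^ s = b ^ s * r ^ (2 * s) := by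
    rw [Real.mul_rpow hb.le (by positivity), hrr]
  have upper : u ^ s ≤ a ^ s * r ^ (2 * s) ∨ u ^ s ≤ b ^ s * r ^ (2 * s) := by
    rcases le_total 0 s with hs | hs
    · right; rw [← e2]; exact Real.rpow_le_rpow hu.le h2 hs
    · left; rw [← e1]; exact Real.rpow_le_rpow_of_nonpos (by positivity) h1 hs
  have lower : a ^ s * r ^ (2 * s) ≤ u ^ s ∨ b ^ s * r ^ (2 * s) ≤ u ^ s := by
    rcases le_total 0 s with hs | hs
    · left; rw [← e1]; exact Real.rpow_le_rpow (by positivity) h1 hs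
    · right; rw [← e2]; exact Real.rpow_le_rpow_of_nonpos hu h2 hs
  constructor
  · have := mul_pos has hrs
    have := mul_pos hbs hrs
    rcases upper with h | h <;> nlinarith
  · have p1 : 0 < (a ^ s)⁻¹ * u ^ s := by positivity
    have p2 : 0 < (b ^ s)⁻¹ * u ^ s := by positivity
    rw [add_mul]
    rcases lower with h | h
    · have := (le_inv_mul_iff₀ has).2 h
      linarith
    · have := (le_inv_mul_iff₀ hbs).2 h
      linarith

/-- if `U : ℝ^m → ℝ` (`m ≥ 2`) is `C²` with `U(0) = 0`, `∇U(0) = 0` and positive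
definite Hessian `A` at `0`, then there is `ε > 0` with `U > 0` on `B(0,ε) \ {0}` and, for every
`β ∈ ℝ`, `∫_{B(0,ε)\{0}} U^{−(1+β)} dx < ∞` iff `β < m/2 − 1`. -/
theorem statement13 {m : ℕ} (hm : 2 ≤ m) (U : EuclideanSpace ℝ (Fin m) → ℝ)
    (hU : ContDiff ℝ 2 U) (hU0 : U 0 = 0) (hgrad0 : gradient U 0 = 0)
    (A : Matrix (Fin m) (Fin m) ℝ) (hApos : A.PosDef)
    (hA : ∀ v, fderiv ℝ (gradient U) 0 v = Matrix.toEuclideanLin A v) :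
    ∃ ε > (0 : ℝ),
      (∀ x : EuclideanSpace ℝ (Fin m), x ≠ 0 → ‖x‖ < ε → 0 < U x) ∧
      ∀ β : ℝ,
        IntegrableOn (fun x => U x ^ (-(1 + β))) (ball (0 : EuclideanSpace ℝ (Fin m)) ε \ {0})
            volume ↔
          β < (m : ℝ) / 2 - 1 := by
  obtain ⟨ε, hε, a, ha, b, hb, hab⟩ := two_sided hm U hU hU0 hgrad0 A hApos hA
  refine ⟨ε, hε, fun x hx hxε => ?_, fun β => ?_⟩
  · have : 0 < ‖x‖ := norm_pos_iff.2 hx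
    exact lt_of_lt_of_le (by positivity) (hab x hxε).1
  have hmain : β < (m : ℝ) / 2 - 1 ↔ -(m : ℝ) < 2 * (-(1 + β)) := by
    constructor <;> intro <;> linarith
  rw [hmain, ← rpow_integrable_iff hm hε]
  have : Nonempty (Fin m) := ⟨⟨0, by omega⟩⟩
  have hset : IntegrableOn (fun x : EuclideanSpace ℝ (Fin m) => ‖x‖ ^ (2 * (-(1 + β))))
      (ball 0 ε) volume ↔ IntegrableOn (fun x : EuclideanSpace ℝ (Fin m) => ‖x‖ ^ (2 * (-(1 + β))))
      (ball 0 ε \ {0}) volume :=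
    integrableOn_congr_set_ae (diff_null_ae_eq_self (by simp)).symm
  rw [hset]
  generalize -(1 + β) = s
  have hms : MeasurableSet (ball (0 : EuclideanSpace ℝ (Fin m)) ε \ {0}) :=
    measurableSet_ball.diff (measurableSet_singleton 0)
  have hcmp : ∀ x ∈ ball (0 : EuclideanSpace ℝ (Fin m)) ε \ {0}, 0 ≤ U x ∧
      U x ^ s ≤ (a ^ s + b ^ s) * ‖x‖ ^ (2 * s) ∧
      ‖x‖ ^ (2 * s) ≤ (a ^ (-s) + b ^ (-s)) * U x ^ s := by
    rintro x ⟨hx, hx0⟩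
    have h := hab x (by simpa using hx)
    exact ⟨le_trans (by positivity) h.1,
      rpow_compare ha hb (norm_pos_iff.2 (by simpa using hx0)) h.1 h.2 s⟩
  have hUm : Measurable U := hU.continuous.measurable
  constructor
  · intro h
    refine Integrable.mono' (h.const_mul (a ^ (-s) + b ^ (-s)))
      (measurable_norm.pow_const _).aestronglyMeasurable ?_
    filter_upwards [ae_restrict_mem hms] with x hx
    rw [Real.norm_of_nonneg (by positivity)]
    exact (hcmp x hx).2.2
  · intro h
    refine Integrable.mono' (h.const_mul (a ^ s + b ^ s))
      (hUm.pow_const _).aestronglyMeasurable ?_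
    filter_upwards [ae_restrict_mem hms] with x hx
    rw [Real.norm_of_nonneg (Real.rpow_nonneg (hcmp x hx).1 _)]
    exact (hcmp x hx).2.1
end
end

section
/- Let m ≥ 2, β ∈ ℝ, and 0 < λ₋ < λ₊. Let D(λ₋,λ₊,m) be the set of m×m diagonal matrices with nondecreasing diagonal entries λ₋ = λ_1 ≤ λ_2 ≤ … ≤ λ_{m-1} ≤ λ_m = λ₊. Then the set {Λ(A,β) : A ∈ D(λ₋,λ₊,m)} is a compact interval contained in [λ₋, λ₊]. -/
open MeasureTheory Metric Filter
open scoped InnerProductSpace RealInnerProductSpace ENNReal NNReal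

noncomputable section

instance sphereUniform_isProb {m : ℕ} [NeZero m] : IsProbabilityMeasure (sphereUniform m) := by
  constructor
  have : Nonempty (Fin m) := ⟨0⟩
  unfold sphereUniform
  rw [Measure.smul_apply, smul_eq_mul]
  apply ENNReal.inv_mul_cancel
  · intro h
    have h2 := Measure.measure_univ_eq_zero.mp h
    exact Measure.toSphere_ne_zero _ h2
  · exact measure_ne_top _ _

theorem quadForm_diag {m : ℕ} (d : Fin m → ℝ) (θ : EuclideanSpace ℝ (Fin m)) :
    quadForm (Matrix.diagonal d) θ = ∑ i, d i * (θ i) ^ 2 := by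
  unfold quadForm
  simp only [PiLp.inner_apply, Matrix.toLpLin_apply, Matrix.mulVec_diagonal]
  refine Finset.sum_congr rfl fun i _ => ?_
  simp
  ring

theorem sphere_sum {m : ℕ} (θ : sphere (0 : EuclideanSpace ℝ (Fin m)) 1) :
    ∑ i, ((θ : EuclideanSpace ℝ (Fin m)) i) ^ 2 = 1 := by
  rw [← EuclideanSpace.real_norm_sq_eq]
  simp

theorem quad_bounds {m : ℕ} {a b : ℝ} (d : Fin m → ℝ) (hd : ∀ i, a ≤ d i ∧ d i ≤ b)
    (θ : sphere (0 : EuclideanSpace ℝ (Fin m)) 1) :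
    a ≤ quadForm (Matrix.diagonal d) θ ∧ quadForm (Matrix.diagonal d) θ ≤ b := by
  rw [quadForm_diag]
  constructor
  · calc a = ∑ i, a * ((θ : EuclideanSpace ℝ (Fin m)) i) ^ 2 := by
          rw [← Finset.mul_sum, sphere_sum, mul_one]
      _ ≤ _ := Finset.sum_le_sum fun i _ => mul_le_mul_of_nonneg_right (hd i).1 (sq_nonneg _)
  · calc _ ≤ ∑ i, b * ((θ : EuclideanSpace ℝ (Fin m)) i) ^ 2 :=
          Finset.sum_le_sum fun i _ => mul_le_mul_of_nonneg_right (hd i).2 (sq_nonneg _)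
      _ = b := by rw [← Finset.mul_sum, sphere_sum, mul_one]

/-- Truncated integrand, jointly continuous in all arguments. -/
def truncG {m : ℕ} (a s : ℝ) (d : Fin m → ℝ) (θ : sphere (0 : EuclideanSpace ℝ (Fin m)) 1) : ℝ :=
  (max (∑ i, d i * ((θ : EuclideanSpace ℝ (Fin m)) i) ^ 2) a) ^ (-s)

theorem truncG_cont {m : ℕ} {a : ℝ} (ha : 0 < a) (s : ℝ) :
    Continuous (Function.uncurry (truncG (m := m) a s)) := by
  unfold truncG Function.uncurry
  refine Continuous.rpow_const ?_ fun x => Or.inl (lt_of_lt_of_le ha (le_max_right _ _)).ne'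
  fun_prop

theorem truncG_pos {m : ℕ} {a : ℝ} (ha : 0 < a) (s : ℝ) (d : Fin m → ℝ)
    (θ : sphere (0 : EuclideanSpace ℝ (Fin m)) 1) : 0 < truncG a s d θ :=
  Real.rpow_pos_of_pos (lt_of_lt_of_le ha (le_max_right _ _)) _

theorem truncG_int {m : ℕ} [NeZero m] {a : ℝ} (ha : 0 < a) (s : ℝ) (d : Fin m → ℝ) :
    Integrable (truncG a s d) (sphereUniform m) := by
  have hc : Continuous (truncG a s d) := (truncG_cont ha s).comp (Continuous.prodMk_right d)
  exact hc.integrable_of_hasCompactSupport (HasCompactSupport.of_compactSpace _)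

theorem truncZ_pos {m : ℕ} [NeZero m] {a : ℝ} (ha : 0 < a) (s : ℝ) (d : Fin m → ℝ) :
    0 < ∫ θ, truncG a s d θ ∂(sphereUniform m) := by
  rw [integral_pos_iff_support_of_nonneg (fun θ => (truncG_pos ha s d θ).le) (truncG_int ha s d)]
  have : Function.support (truncG a s d) = Set.univ := by
    ext θ
    simp [(truncG_pos ha s d θ).ne']
  rw [this]
  simp

theorem truncZ_cont {m : ℕ} [NeZero m] {a : ℝ} (ha : 0 < a) (s : ℝ) :
    Continuous fun d : Fin m → ℝ => ∫ θ, truncG a s d θ ∂(sphereUniform m) := by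
  have := continuous_parametric_integral_of_continuous (μ := sphereUniform m)
    (truncG_cont (m := m) ha s) isCompact_univ
  simpa using this

theorem Zfun_eq {m : ℕ} {a b : ℝ} (s : ℝ) (d : Fin m → ℝ) (hd : ∀ i, a ≤ d i ∧ d i ≤ b) :
    Zfun (Matrix.diagonal d) s = ∫ θ, truncG a s d θ ∂(sphereUniform m) := by
  unfold Zfun
  refine integral_congr_ae (Eventually.of_forall fun θ => ?_)
  have h := (quad_bounds d hd θ).1
  simp only [truncG]
  rw [← quadForm_diag, max_eq_left h]

theorem lambda_bounds {m : ℕ} [NeZero m] {a b : ℝ} (ha : 0 < a) (β : ℝ) (d : Fin m → ℝ)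
    (hd : ∀ i, a ≤ d i ∧ d i ≤ b) :
    lambdaAvg (Matrix.diagonal d) β ∈ Set.Icc a b := by
  have hp := truncZ_pos ha (1 + β) d
  have key : ∀ θ, a * truncG a (1 + β) d θ ≤ truncG a β d θ ∧
      truncG a β d θ ≤ b * truncG a (1 + β) d θ := by
    intro θ
    have h := quad_bounds d hd θ
    have hq : 0 < max (∑ i, d i * ((θ : EuclideanSpace ℝ (Fin m)) i) ^ 2) a :=
      lt_of_lt_of_le ha (le_max_right _ _)
    have e : truncG a β d θ = quadForm (Matrix.diagonal d) θ * truncG a (1 + β) d θ := by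
      have : quadForm (Matrix.diagonal d) θ
          = max (∑ i, d i * ((θ : EuclideanSpace ℝ (Fin m)) i) ^ 2) a := by
        rw [← quadForm_diag, max_eq_left h.1]
      rw [this]
      unfold truncG
      rw [show -β = 1 + -(1 + β) by ring, Real.rpow_add hq, Real.rpow_one]
    rw [e]
    have := (truncG_pos ha (1 + β) d θ).le
    exact ⟨mul_le_mul_of_nonneg_right h.1 this, mul_le_mul_of_nonneg_right h.2 this⟩
  unfold lambdaAvg
  rw [Zfun_eq β d hd, Zfun_eq (1 + β) d hd]
  constructor
  · rw [le_div_iff₀ hp, ← integral_const_mul]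
    exact integral_mono ((truncG_int ha _ d).const_mul _) (truncG_int ha _ d) fun θ => (key θ).1
  · rw [div_le_iff₀ hp, ← integral_const_mul]
    exact integral_mono (truncG_int ha _ d) ((truncG_int ha _ d).const_mul _) fun θ => (key θ).2

/-- for `m ≥ 2`, `β ∈ ℝ` and `0 < λ₋ < λ₊`, the image of the set
`D(λ₋,λ₊,m)` of diagonal matrices with nondecreasing diagonal entries going from `λ₋` to `λ₊`
under `A ↦ Λ(A,β)` is a compact interval contained in `[λ₋,λ₊]`. -/
theorem statement14 {m : ℕ} (hm : 2 ≤ m) (β lamm lamp : ℝ)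
    (h0 : 0 < lamm) (h1 : lamm < lamp) :
    ∃ a b : ℝ, a ≤ b ∧
      (fun A => lambdaAvg A β) ''
          {A : Matrix (Fin m) (Fin m) ℝ |
            (∀ i j, i ≠ j → A i j = 0) ∧ Monotone (fun i => A i i) ∧
              A ⟨0, by omega⟩ ⟨0, by omega⟩ = lamm ∧
              A ⟨m - 1, by omega⟩ ⟨m - 1, by omega⟩ = lamp} =
        Set.Icc a b ∧
      Set.Icc a b ⊆ Set.Icc lamm lamp := by
  have : NeZero m := ⟨by omega⟩
  let i0 : Fin m := ⟨0, by omega⟩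
  let i1 : Fin m := ⟨m - 1, by omega⟩
  let K : Set (Fin m → ℝ) := {d | Monotone d ∧ d i0 = lamm ∧ d i1 = lamp}
  have hKb : ∀ d ∈ K, ∀ i, lamm ≤ d i ∧ d i ≤ lamp := by
    rintro d ⟨hmono, h2, h3⟩ i
    constructor
    · rw [← h2]
      exact hmono (Fin.mk_le_of_le_val (Nat.zero_le _))
    · rw [← h3]
      refine hmono (Fin.le_def.mpr ?_)
      have := i.2
      change (i : ℕ) ≤ m - 1
      omega
  have himg : (fun A => lambdaAvg A β) ''
          {A : Matrix (Fin m) (Fin m) ℝ |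
            (∀ i j, i ≠ j → A i j = 0) ∧ Monotone (fun i => A i i) ∧
              A ⟨0, by omega⟩ ⟨0, by omega⟩ = lamm ∧
              A ⟨m - 1, by omega⟩ ⟨m - 1, by omega⟩ = lamp} =
      (fun d => lambdaAvg (Matrix.diagonal d) β) '' K := by
    ext x
    constructor
    · rintro ⟨A, ⟨hA, hA2, hA3, hA4⟩, rfl⟩
      refine ⟨fun i => A i i, ⟨hA2, hA3, hA4⟩, ?_⟩
      have : Matrix.diagonal (fun i => A i i) = A := by
        ext i j
        by_cases hij : i = j
        · subst hij
          simp
        · rw [Matrix.diagonal_apply_ne _ hij, hA i j hij]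
      simp only [this]
    · rintro ⟨d, ⟨hd1, hd2, hd3⟩, rfl⟩
      refine ⟨Matrix.diagonal d, ⟨fun i j hij => Matrix.diagonal_apply_ne _ hij, ?_, ?_, ?_⟩, rfl⟩
      · simpa using hd1
      · exact (Matrix.diagonal_apply_eq d i0).trans hd2
      · exact (Matrix.diagonal_apply_eq d i1).trans hd3
  have hcont : ContinuousOn (fun d => lambdaAvg (Matrix.diagonal d) β) K := by
    have hc : Continuous fun d : Fin m → ℝ => (∫ θ, truncG lamm β d θ ∂(sphereUniform m)) /
        ∫ θ, truncG lamm (1 + β) d θ ∂(sphereUniform m) :=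
      (truncZ_cont h0 β).div (truncZ_cont h0 (1 + β)) fun d => (truncZ_pos h0 (1 + β) d).ne'
    refine hc.continuousOn.congr fun d hd => ?_
    simp only [lambdaAvg]
    rw [Zfun_eq β d (hKb d hd), Zfun_eq (1 + β) d (hKb d hd)]
  have hclosed : IsClosed K := by
    refine IsClosed.inter isClosed_monotone (IsClosed.inter ?_ ?_)
    · exact isClosed_eq (continuous_apply i0) continuous_const
    · exact isClosed_eq (continuous_apply i1) continuous_const
  have hcomp : IsCompact K := by
    refine (isCompact_univ_pi fun _ : Fin m => isCompact_Icc (a := lamm) (b := lamp)).of_isClosed_subset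
      hclosed fun d hd i _ => hKb d hd i
  have hconv : Convex ℝ K := by
    rintro d ⟨d1, d2, d3⟩ e ⟨e1, e2, e3⟩ s t hs ht hst
    refine ⟨fun i j hij => ?_, ?_, ?_⟩
    · have := mul_le_mul_of_nonneg_left (d1 hij) hs
      have := mul_le_mul_of_nonneg_left (e1 hij) ht
      simp only [Pi.add_apply, Pi.smul_apply, smul_eq_mul]
      linarith
    · simp only [Pi.add_apply, Pi.smul_apply, smul_eq_mul, d2, e2]
      rw [← add_mul, hst, one_mul]
    · simp only [Pi.add_apply, Pi.smul_apply, smul_eq_mul, d3, e3]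
      rw [← add_mul, hst, one_mul]
  have hne : K.Nonempty := by
    refine ⟨fun i => if (i : ℕ) = 0 then lamm else lamp, fun i j hij => ?_, ?_, ?_⟩
    · have hij' : (i : ℕ) ≤ j := hij
      dsimp only
      split_ifs with ha hb
      · exact le_rfl
      · exact h1.le
      · omega
      · exact le_rfl
    · simp [i0]
    · have : m - 1 ≠ 0 := by omega
      simp [i1, this]
  rw [himg]
  have hIc := eq_Icc_of_connected_compact
    (⟨hne.image _, hconv.isPreconnected.image _ hcont⟩ :
      IsConnected ((fun d => lambdaAvg (Matrix.diagonal d) β) '' K))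
    (hcomp.image_of_continuousOn hcont)
  have hsub : (fun d => lambdaAvg (Matrix.diagonal d) β) '' K ⊆ Set.Icc lamm lamp := by
    rintro _ ⟨d, hd, rfl⟩
    exact lambda_bounds h0 β d (hKb d hd)
  refine ⟨_, _, ?_, hIc, hIc ▸ hsub⟩
  have hne2 := hne.image (fun d => lambdaAvg (Matrix.diagonal d) β)
  rw [hIc] at hne2
  exact Set.nonempty_Icc.mp hne2
end
end

section
/- Let m ≥ 2, let U : ℝ^m → ℝ be twice continuously differentiable with U(0) = 0, ∇U(0) = 0, and Hessian A of U at 0 positive definite, and let β ∈ ℝ. Then (choosing ε > 0 small enough that U > 0 on B(0,ε) \ {0}) the function x ↦ −ΔU(x) + (1+β)‖∇U(x)‖²/U(x), which equals the operator f ↦ U·Δf − β⟨∇U,∇f⟩ applied to −ln U, satisfies: −ΔU(ρθ) + (1+β)‖∇U(ρθ)‖²/U(ρθ) converges to −tr(A) + 2(1+β)⟨θ,A²θ⟩/⟨θ,Aθ⟩ as ρ → 0+, uniformly over θ in the unit sphere S^{m-1}. -/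
open Metric Filter MeasureTheory
open scoped InnerProductSpace RealInnerProductSpace Topology

noncomputable section

lemma aux_grad {m : ℕ} (U : EuclideanSpace ℝ (Fin m) → ℝ) (y e : EuclideanSpace ℝ (Fin m)) :
    fderiv ℝ U y e = ⟪gradient U y, e⟫_ℝ := by
  unfold gradient
  rw [InnerProductSpace.toDual_symm_apply]

lemma aux_grad_contDiff {m : ℕ} (U : EuclideanSpace ℝ (Fin m) → ℝ) (hU : ContDiff ℝ 2 U) :
    ContDiff ℝ 1 (gradient U) := by
  have h : ContDiff ℝ 1 (fderiv ℝ U) := hU.fderiv_right (by norm_num)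
  exact (InnerProductSpace.toDual ℝ (EuclideanSpace ℝ (Fin m))).symm.contDiff.comp h

lemma aux_lap {m : ℕ} (U : EuclideanSpace ℝ (Fin m) → ℝ) (hU : ContDiff ℝ 2 U)
    (x : EuclideanSpace ℝ (Fin m)) :
    laplacian U x = ∑ i : Fin m, ⟪fderiv ℝ (gradient U) x (EuclideanSpace.single i (1 : ℝ)),
      EuclideanSpace.single i (1 : ℝ)⟫_ℝ := by
  unfold laplacian
  refine Finset.sum_congr rfl fun i _ => ?_
  have h1 : DifferentiableAt ℝ (gradient U) x :=
    (aux_grad_contDiff U hU).differentiable (by norm_num) x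
  have h2 : (fun y => fderiv ℝ U y (EuclideanSpace.single i (1 : ℝ))) =
      fun y => ⟪gradient U y, EuclideanSpace.single i (1 : ℝ)⟫_ℝ :=
    funext fun y => aux_grad U y _
  rw [h2, fderiv_inner_apply ℝ h1 (differentiableAt_const _)]
  simp

lemma aux_lap_cont {m : ℕ} (U : EuclideanSpace ℝ (Fin m) → ℝ) (hU : ContDiff ℝ 2 U) :
    Continuous (laplacian U) := by
  have h : laplacian U = _ := funext (aux_lap U hU)
  rw [h]
  have h2 : Continuous (fderiv ℝ (gradient U)) :=
    (aux_grad_contDiff U hU).continuous_fderiv (by norm_num)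
  fun_prop

lemma aux_lap_zero {m : ℕ} (U : EuclideanSpace ℝ (Fin m) → ℝ) (hU : ContDiff ℝ 2 U)
    (A : Matrix (Fin m) (Fin m) ℝ)
    (hA : ∀ v, fderiv ℝ (gradient U) 0 v = Matrix.toEuclideanLin A v) :
    laplacian U 0 = A.trace := by
  rw [aux_lap U hU, Matrix.trace]
  refine Finset.sum_congr rfl fun i _ => ?_
  rw [hA]
  simp [EuclideanSpace.inner_single_right, Matrix.toLpLin_apply]

/-- second-order Taylor estimate -/
lemma aux_taylor {m : ℕ} (U : EuclideanSpace ℝ (Fin m) → ℝ)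
    (hU : ContDiff ℝ 2 U) (hU0 : U 0 = 0)
    (T : EuclideanSpace ℝ (Fin m) →L[ℝ] EuclideanSpace ℝ (Fin m))
    (hT : ∀ x y, ⟪T x, y⟫_ℝ = ⟪x, T y⟫_ℝ)
    (ho : (fun x => gradient U x - T x) =o[𝓝 0] (fun x => x)) :
    (fun x => U x - 1 / 2 * ⟪x, T x⟫_ℝ) =o[𝓝 0] (fun x => ‖x‖ ^ 2) := by
  rw [Asymptotics.isLittleO_iff] at ho ⊢
  intro c hc
  obtain ⟨δ, hδ, hb⟩ := Metric.eventually_nhds_iff_ball.1 (ho hc)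
  refine Metric.eventually_nhds_iff_ball.2 ⟨δ, hδ, fun x hx => ?_⟩
  have hx' : ‖x‖ < δ := by simpa using hx
  have hd : ∀ y, HasFDerivAt (fun x => U x - 1 / 2 * ⟪x, T x⟫_ℝ)
      (innerSL ℝ (gradient U y - T y)) y := by
    intro y
    have h1 : HasFDerivAt U (fderiv ℝ U y) y := (hU.differentiable (by norm_num) y).hasFDerivAt
    have h2 := ((hasFDerivAt_id y).inner ℝ (T.hasFDerivAt (x := y))).const_mul (1 / 2 : ℝ)
    refine (h1.sub h2).congr_fderiv ?_
    ext v
    have h3 : ⟪y, T v⟫_ℝ = ⟪T y, v⟫_ℝ := (hT y v).symm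
    have h4 : ⟪v, T y⟫_ℝ = ⟪T y, v⟫_ℝ := real_inner_comm _ _
    simp [inner_sub_left, h3, h4]
    ring
  have := (convex_closedBall (0 : EuclideanSpace ℝ (Fin m)) ‖x‖).norm_image_sub_le_of_norm_hasFDerivWithin_le
    (C := c * ‖x‖) (fun y _ => (hd y).hasFDerivWithinAt) (fun y hy => by
      have hy' : ‖y‖ ≤ ‖x‖ := by simpa using hy
      rw [innerSL_apply_norm]
      refine (hb y (by simpa using hy'.trans_lt hx')).trans (by gcongr))
    (x := 0) (y := x) (by simp) (by simp)
  simp only [hU0, map_zero, inner_zero_left, mul_zero, sub_zero] at this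
  rw [norm_pow, norm_norm]
  linarith [this, sq ‖x‖, mul_assoc c ‖x‖ ‖x‖, congrArg (c * ·) (sq ‖x‖)]

/-- if `U : ℝ^m → ℝ` (`m ≥ 2`) is `C²` with `U(0) = 0`, `∇U(0) = 0`, positive
definite Hessian `A` at `0`, and `β ∈ ℝ`, then `L_β(−ln U) = −ΔU + (1+β)‖∇U‖²/U` satisfies
`−ΔU(ρθ) + (1+β)‖∇U(ρθ)‖²/U(ρθ) → −tr(A) + 2(1+β)⟨θ,A²θ⟩/⟨θ,Aθ⟩` as `ρ → 0⁺`, uniformly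
over `θ ∈ S^{m-1}`. -/
theorem statement19 {m : ℕ} (hm : 2 ≤ m) (U : EuclideanSpace ℝ (Fin m) → ℝ)
    (hU : ContDiff ℝ 2 U) (hU0 : U 0 = 0) (hgrad0 : gradient U 0 = 0)
    (A : Matrix (Fin m) (Fin m) ℝ) (hApos : A.PosDef)
    (hA : ∀ v, fderiv ℝ (gradient U) 0 v = Matrix.toEuclideanLin A v) (β : ℝ) :
    TendstoUniformlyOn
      (fun ρ : ℝ => fun θ : EuclideanSpace ℝ (Fin m) =>
        -laplacian U (ρ • θ) + (1 + β) * ‖gradient U (ρ • θ)‖ ^ 2 / U (ρ • θ))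
      (fun θ =>
        -A.trace +
          2 * (1 + β) *
            (⟪θ, Matrix.toEuclideanLin (A * A) θ⟫_ℝ / ⟪θ, Matrix.toEuclideanLin A θ⟫_ℝ))
      (𝓝[>] (0 : ℝ)) (sphere (0 : EuclideanSpace ℝ (Fin m)) 1) := by
  let T : EuclideanSpace ℝ (Fin m) →L[ℝ] EuclideanSpace ℝ (Fin m) := LinearMap.toContinuousLinearMap (Matrix.toEuclideanLin A)
  have hTA : ∀ v, Matrix.toEuclideanLin A v = T v := fun v => rfl
  have hTT : ∀ v, Matrix.toEuclideanLin (A * A) v = T (T v) := by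
    intro v
    simp [← hTA, Matrix.toLpLin_apply, Matrix.mulVec_mulVec]
  have hsymm : ∀ x y : EuclideanSpace ℝ (Fin m), ⟪T x, y⟫_ℝ = ⟪x, T y⟫_ℝ :=
    Matrix.isSymmetric_toEuclideanLin_iff.2 hApos.isHermitian
  have hpos : ∀ x : EuclideanSpace ℝ (Fin m), x ≠ 0 → 0 < ⟪x, T x⟫_ℝ := by
    intro x hx
    have := hApos.dotProduct_mulVec_pos (x := x.ofLp) (by simpa using hx)
    have h2 : ⟪x, T x⟫_ℝ = x.ofLp ⬝ᵥ A.mulVec x.ofLp := by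
      rw [← hTA, EuclideanSpace.inner_eq_star_dotProduct, dotProduct_comm]
      simp [Matrix.toLpLin_apply]
    rw [h2]
    simpa using this
  have hTd : fderiv ℝ (gradient U) 0 = T := ContinuousLinearMap.ext hA
  have hg : (fun x => gradient U x - T x) =o[𝓝 0] (fun x => x) := by
    have h1 : HasFDerivAt (gradient U) T 0 := by
      rw [← hTd]
      exact ((aux_grad_contDiff U hU).differentiable (by norm_num) 0).hasFDerivAt
    have := h1.isLittleO
    simpa [hgrad0] using this
  have ht := aux_taylor U hU hU0 T hsymm hg
  simp only [hTA, hTT]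
  rw [← tendstoLocallyUniformlyOn_iff_tendstoUniformlyOn_of_compact (isCompact_sphere _ _),
    tendstoLocallyUniformlyOn_iff_forall_tendsto]
  intro θ₀ hθ₀
  have hθ₀n : θ₀ ≠ 0 := by
    rintro rfl
    simp at hθ₀
  set l : Filter (ℝ × EuclideanSpace ℝ (Fin m)) := 𝓝[>] (0 : ℝ) ×ˢ 𝓝[sphere (0 : EuclideanSpace ℝ (Fin m)) 1] θ₀ with hl
  have l2 : Tendsto (fun y : ℝ × EuclideanSpace ℝ (Fin m) => y.2) l (𝓝 θ₀) := tendsto_snd.mono_right nhdsWithin_le_nhds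
  have l1 : Tendsto (fun y : ℝ × EuclideanSpace ℝ (Fin m) => y.1) l (𝓝 0) := tendsto_fst.mono_right nhdsWithin_le_nhds
  have lpos : ∀ᶠ y in l, 0 < y.1 := tendsto_fst.eventually self_mem_nhdsWithin
  have lnorm : ∀ᶠ y in l, ‖y.2‖ = 1 := by
    filter_upwards [tendsto_snd.eventually (self_mem_nhdsWithin : sphere (0 : EuclideanSpace ℝ (Fin m)) 1 ∈ _)] with y hy
    exact mem_sphere_zero_iff_norm.1 hy
  have lx : Tendsto (fun y : ℝ × EuclideanSpace ℝ (Fin m) => y.1 • y.2) l (𝓝 0) := by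
    simpa using l1.smul l2
  have ipos := hpos θ₀ hθ₀n
  have hG : Tendsto (fun y : ℝ × EuclideanSpace ℝ (Fin m) => y.1⁻¹ • gradient U (y.1 • y.2)) l (𝓝 (T θ₀)) := by
    have h1 : Tendsto (fun y : ℝ × EuclideanSpace ℝ (Fin m) => y.1⁻¹ • (gradient U (y.1 • y.2) - T (y.1 • y.2))) l (𝓝 0) := by
      have h := hg.comp_tendsto lx
      rw [Asymptotics.isLittleO_iff] at h
      rw [Metric.tendsto_nhds]
      intro ε hε
      filter_upwards [h (half_pos hε), lpos, lnorm] with y h1 h2 h3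
      simp only [Function.comp_apply, norm_smul, h3, Real.norm_of_nonneg h2.le, mul_one] at h1
      rw [dist_zero_right, norm_smul, norm_inv, Real.norm_of_nonneg h2.le, inv_mul_lt_iff₀ h2]
      nlinarith
    have h2 := h1.add ((T.continuous.tendsto θ₀).comp l2)
    rw [zero_add] at h2
    refine h2.congr' ?_
    filter_upwards [lpos] with y hy
    simp [smul_sub, smul_smul, inv_mul_cancel₀ hy.ne']
  have hV : Tendsto (fun y : ℝ × EuclideanSpace ℝ (Fin m) => (y.1 ^ 2)⁻¹ * U (y.1 • y.2)) l (𝓝 (1 / 2 * ⟪θ₀, T θ₀⟫_ℝ)) := by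
    have h1 : Tendsto (fun y : ℝ × EuclideanSpace ℝ (Fin m) => (y.1 ^ 2)⁻¹ *
        (U (y.1 • y.2) - 1 / 2 * ⟪y.1 • y.2, T (y.1 • y.2)⟫_ℝ)) l (𝓝 0) := by
      have h := ht.comp_tendsto lx
      rw [Asymptotics.isLittleO_iff] at h
      rw [Metric.tendsto_nhds]
      intro ε hε
      filter_upwards [h (half_pos hε), lpos, lnorm] with y h1 h2 h3
      have h4 : 0 < y.1 ^ 2 := by positivity
      simp only [Function.comp_apply, norm_smul, h3, Real.norm_of_nonneg h2.le, mul_one,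
        Real.norm_of_nonneg h4.le] at h1
      rw [dist_zero_right, norm_mul, norm_inv, Real.norm_of_nonneg h4.le, inv_mul_lt_iff₀ h4]
      nlinarith
    have h2 := h1.add ((l2.inner ((T.continuous.tendsto θ₀).comp l2)).const_mul (1 / 2 : ℝ))
    rw [zero_add] at h2
    refine h2.congr' ?_
    filter_upwards [lpos] with y hy
    simp only [map_smul, inner_smul_left, inner_smul_right, Function.comp_apply]
    simp
    field_simp
    ring
  have hL : Tendsto (fun y : ℝ × EuclideanSpace ℝ (Fin m) => laplacian U (y.1 • y.2)) l (𝓝 A.trace) := by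
    rw [← aux_lap_zero U hU A hA]
    exact ((aux_lap_cont U hU).tendsto 0).comp lx
  have hsq : ⟪θ₀, T (T θ₀)⟫_ℝ = ‖T θ₀‖ ^ 2 := by
    rw [← hsymm, real_inner_self_eq_norm_sq]
  have hF : Tendsto (fun y : ℝ × EuclideanSpace ℝ (Fin m) => -laplacian U (y.1 • y.2) +
      (1 + β) * ‖gradient U (y.1 • y.2)‖ ^ 2 / U (y.1 • y.2)) l
      (𝓝 (-A.trace + 2 * (1 + β) * (⟪θ₀, T (T θ₀)⟫_ℝ / ⟪θ₀, T θ₀⟫_ℝ))) := by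
    have h := hL.neg.add (((hG.norm.pow 2).const_mul (1 + β)).div hV (by positivity))
    have e : -A.trace + (1 + β) * ‖T θ₀‖ ^ 2 / (1 / 2 * ⟪θ₀, T θ₀⟫_ℝ) =
        -A.trace + 2 * (1 + β) * (⟪θ₀, T (T θ₀)⟫_ℝ / ⟪θ₀, T θ₀⟫_ℝ) := by
      rw [hsq]
      field_simp
    rw [e] at h
    refine h.congr' ?_
    filter_upwards [lpos] with y hy
    have h4 : y.1 ^ 2 ≠ 0 := by positivity
    simp only [Pi.div_apply, norm_smul, norm_inv, Real.norm_of_nonneg hy.le, mul_pow, inv_pow]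
    rw [mul_left_comm, mul_div_mul_left _ _ (inv_ne_zero h4)]
  have hf : Tendsto (fun y : ℝ × EuclideanSpace ℝ (Fin m) => -A.trace + 2 * (1 + β) * (⟪y.2, T (T y.2)⟫_ℝ / ⟪y.2, T y.2⟫_ℝ)) l
      (𝓝 (-A.trace + 2 * (1 + β) * (⟪θ₀, T (T θ₀)⟫_ℝ / ⟪θ₀, T θ₀⟫_ℝ))) := by
    have hT1 := (T.continuous.tendsto θ₀).comp l2
    have hT2 := (T.continuous.tendsto _).comp hT1
    exact (((l2.inner hT2).div (l2.inner hT1) ipos.ne').const_mul _).const_add _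
  exact (hf.prodMk_nhds hF).mono_right (nhds_le_uniformity _)
end
end
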